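/- arXiv:1010.1536 — 2 statements merged into one kernel-verified Lean document; each statement's English description precedes it below -/
import Mathlib

section
/- Let (R, 𝔪, k) be a Gorenstein Noetherian local ring of Krull dimension d ≥ 2 and let M be a finitely generated R-module with a resolution F_{d−1} →f_{d−1} ⋯ → F₁ →f₁ F₀ → M → 0 by finite free R-modules; for 0 ≤ i ≤ d−2 set λΩ^i M := image(f_{i+1}* : Hom_R(F_i,R) → Hom_R(F_{i+1},R)). Then M is sequentially Cohen-Macaulay if and only if depth_R(λΩ^i M) ≥ d−i for all i with 0 ≤ i ≤ d−2. -/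
open CategoryTheory Opposite IsLocalRing

/-- The Ext module `Ext^i_R(M, N)` as an object of `ModuleCat R`. -/
noncomputable def extMod (R : Type) [CommRing R] (M N : Type) [AddCommGroup M] [Module R M]
    [AddCommGroup N] [Module R N] (i : ℕ) : ModuleCat R :=
  ((Ext R (ModuleCat R) i).obj (op (ModuleCat.of R M))).obj (ModuleCat.of R N)

/-- The Tor module `Tor_i^R(M, N)` as an object of `ModuleCat R`. -/
noncomputable def torMod (R : Type) [CommRing R] (M N : Type) [AddCommGroup M] [Module R M]
    [AddCommGroup N] [Module R N] (i : ℕ) : ModuleCat R :=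
  ((Tor (ModuleCat R) i).obj (ModuleCat.of R M)).obj (ModuleCat.of R N)

/-- The depth of a module over a Noetherian local ring: the least `i` such that
`Ext^i_R(k, M) ≠ 0`, with the convention `depth 0 = ⊤` (as `sInf ∅ = ⊤` in `ℕ∞`). -/
noncomputable def rdepth (R : Type) [CommRing R] [IsLocalRing R] (M : Type) [AddCommGroup M]
    [Module R M] : ℕ∞ :=
  sInf {n : ℕ∞ | ∃ i : ℕ, Nontrivial (extMod R (ResidueField R) M i) ∧ n = i}

/-- The Krull dimension of a module: `dim R⧸Ann M`. -/
noncomputable def mdim (R : Type) [CommRing R] (M : Type) [AddCommGroup M] [Module R M] :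
    WithBot ℕ∞ :=
  ringKrullDim (R ⧸ Module.annihilator R M)

/-- `M` is Cohen-Macaulay of dimension `n`: depth and dimension both equal `n`. -/
def isCMofDim (R : Type) [CommRing R] [IsLocalRing R] (M : Type) [AddCommGroup M] [Module R M]
    (n : ℕ) : Prop :=
  rdepth R M = (n : ℕ∞) ∧ mdim R M = (n : ℕ)

/-- `M` is Cohen-Macaulay: depth equals dimension. -/
def isCM (R : Type) [CommRing R] [IsLocalRing R] (M : Type) [AddCommGroup M] [Module R M] : Prop :=
  (rdepth R M : WithBot ℕ∞) = mdim R M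

/-- `R` is a Cohen-Macaulay local ring of dimension `d`. -/
def isCMLocalRing (R : Type) [CommRing R] [IsLocalRing R] (d : ℕ) : Prop :=
  ringKrullDim R = (d : ℕ) ∧ rdepth R R = (d : ℕ∞)

/-- `M` has Sliding Depth of Extension modules: for `1 ≤ i ≤ d-1`, either `Ext^i(M,R) = 0`
or `depth Ext^i(M,R) ≥ d - i`. -/
def isSDE (R : Type) [CommRing R] [IsLocalRing R] (M : Type) [AddCommGroup M] [Module R M]
    (d : ℕ) : Prop :=
  ∀ i : ℕ, 1 ≤ i → i ≤ d - 1 →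
    Subsingleton (extMod R M R i) ∨ ((d - i : ℕ) : ℕ∞) ≤ rdepth R (extMod R M R i)

/-- `M` has Cohen-Macaulay Extension modules: for `1 ≤ i ≤ d-1`, either `Ext^i(M,R) = 0`
or `Ext^i(M,R)` is Cohen-Macaulay of dimension `d - i`. -/
def isCME (R : Type) [CommRing R] [IsLocalRing R] (M : Type) [AddCommGroup M] [Module R M]
    (d : ℕ) : Prop :=
  ∀ i : ℕ, 1 ≤ i → i ≤ d - 1 →
    Subsingleton (extMod R M R i) ∨ isCMofDim R (extMod R M R i) (d - i)

/-- `M` is sequentially Cohen-Macaulay: it has a filtration with Cohen-Macaulay quotients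
of strictly increasing dimensions. -/
def isSeqCM (R : Type) [CommRing R] [IsLocalRing R] (M : Type) [AddCommGroup M] [Module R M] :
    Prop :=
  ∃ (r : ℕ) (Φ : Fin (r + 1) → Submodule R M), Φ 0 = ⊥ ∧ Φ (Fin.last r) = ⊤ ∧ StrictMono Φ ∧
    (∀ i : Fin r, isCM R (↥(Φ i.succ) ⧸ (Φ i.castSucc).comap (Φ i.succ).subtype)) ∧
    (∀ i j : Fin r, i < j →
      mdim R (↥(Φ i.succ) ⧸ (Φ i.castSucc).comap (Φ i.succ).subtype) <
      mdim R (↥(Φ j.succ) ⧸ (Φ j.castSucc).comap (Φ j.succ).subtype))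

/-- `ω` is a canonical module of the `d`-dimensional local ring `R`:
`Ext^i_R(k, ω) = 0` for `i ≠ d` and `Ext^d_R(k, ω) ≅ k`. -/
def isCanonicalModule (R : Type) [CommRing R] [IsLocalRing R] (d : ℕ) (ω : Type)
    [AddCommGroup ω] [Module R ω] : Prop :=
  Module.Finite R ω ∧ (∀ i : ℕ, i ≠ d → Subsingleton (extMod R (ResidueField R) ω i)) ∧
    Nonempty ((extMod R (ResidueField R) ω d) ≃ₗ[R] ResidueField R)

/-- The local cohomology module `H^i_𝔪(M)` supported at the maximal ideal. -/
noncomputable def lcMod (R : Type) [CommRing R] [IsLocalRing R] (i : ℕ) (M : Type)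
    [AddCommGroup M] [Module R M] : ModuleCat R :=
  (localCohomology (maximalIdeal R) i).obj (ModuleCat.of R M)

/-- The 𝔪-torsion submodule `Γ_𝔪(M) = {x ∈ M | 𝔪^n x = 0 for some n}`. -/
noncomputable def mTorsion (R : Type) [CommRing R] [IsLocalRing R] (M : Type) [AddCommGroup M]
    [Module R M] : Submodule R M :=
  ⨆ n : ℕ, Submodule.torsionBySet R M ((maximalIdeal R ^ n : Ideal R) : Set R)

/-- The natural evaluation (biduality) map `M → Hom_R(Hom_R(M, ω), ω)`. -/
noncomputable def evMap (R : Type) [CommRing R] (M ω : Type) [AddCommGroup M] [Module R M]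
    [AddCommGroup ω] [Module R ω] : M →ₗ[R] ((M →ₗ[R] ω) →ₗ[R] ω) :=
  (LinearMap.id : (M →ₗ[R] ω) →ₗ[R] (M →ₗ[R] ω)).flip

/-- Serre's condition `(S₂)` on the punctured spectrum. -/
def serreS2Punctured (R : Type) [CommRing R] [IsLocalRing R] (M : Type) [AddCommGroup M]
    [Module R M] : Prop :=
  ∀ (𝔭 : Ideal R) [𝔭.IsPrime], 𝔭 ≠ maximalIdeal R →
    min (2 : WithBot ℕ∞) (mdim (Localization.AtPrime 𝔭) (LocalizedModule 𝔭.primeCompl M)) ≤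
      (rdepth (Localization.AtPrime 𝔭) (LocalizedModule 𝔭.primeCompl M) : WithBot ℕ∞)

section ExtSequences

variable {R : Type} [CommRing R]

/-- The module `Ext^i_R(A, B)` built from `CategoryTheory.Abelian.Ext`. -/
abbrev ExtGroup (R : Type) [CommRing R] (A B : Type) [AddCommGroup A] [Module R A]
    [AddCommGroup B] [Module R B] (i : ℕ) : Type :=
  Abelian.Ext (ModuleCat.of R A) (ModuleCat.of R B) i

variable {A B C Y : Type} [AddCommGroup A] [Module R A] [AddCommGroup B] [Module R B]
  [AddCommGroup C] [Module R C] [AddCommGroup Y] [Module R Y]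

/-- Short exact sequences of modules, in terms of linear maps. -/
structure IsShortExact (f : A →ₗ[R] B) (g : B →ₗ[R] C) : Prop where
  inj : Function.Injective f
  exact : Function.Exact f g
  surj : Function.Surjective g

namespace IsShortExact

variable {f : A →ₗ[R] B} {g : B →ₗ[R] C}

/-- The bundled short complex underlying a short exact sequence of linear maps. -/
def complex (h : IsShortExact f g) : ShortComplex (ModuleCat.{0} R) :=
  ModuleCat.shortComplexOfCompEqZero f g h.exact.linearMap_comp_eq_zero

theorem complex_shortExact (h : IsShortExact f g) : h.complex.ShortExact := by
  have h1 : Mono h.complex.f := (ModuleCat.mono_iff_injective _).2 h.inj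
  have h2 : Epi h.complex.g := (ModuleCat.epi_iff_surjective _).2 h.surj
  exact ⟨ModuleCat.shortComplex_exact _ h.exact⟩

theorem of_surjective (g : B →ₗ[R] C) (hg : Function.Surjective g) :
    IsShortExact (LinearMap.ker g).subtype g :=
  ⟨Subtype.val_injective, LinearMap.exact_subtype_ker_map g, hg⟩

theorem of_mkQ (S : Submodule R B) : IsShortExact S.subtype S.mkQ :=
  ⟨Subtype.val_injective, LinearMap.exact_subtype_mkQ S, S.mkQ_surjective⟩

theorem of_rangeRestrict (g : B →ₗ[R] C) :
    IsShortExact (LinearMap.ker g).subtype g.rangeRestrict := by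
  refine ⟨Subtype.val_injective, fun x => ?_, LinearMap.surjective_rangeRestrict g⟩
  have h : g.rangeRestrict x = 0 ↔ g x = 0 := by
    rw [← Subtype.coe_inj]
    rfl
  rw [h]
  exact LinearMap.exact_subtype_ker_map g x

end IsShortExact

/-- The contravariant functoriality of `ExtGroup`. -/
noncomputable def extMap (f : A →ₗ[R] B) (Y : Type) [AddCommGroup Y] [Module R Y] (i : ℕ) :
    ExtGroup R B Y i →ₗ[R] ExtGroup R A Y i :=
  (Abelian.Ext.mk₀ (ModuleCat.ofHom f)).precompOfLinear R _ (zero_add i)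

/-- The contravariant connecting map of a short exact sequence. -/
noncomputable def extConn {f : A →ₗ[R] B} {g : B →ₗ[R] C} (h : IsShortExact f g) (Y : Type)
    [AddCommGroup Y] [Module R Y] (i : ℕ) :
    ExtGroup R A Y i →ₗ[R] ExtGroup R C Y (i + 1) :=
  h.complex_shortExact.extClass.precompOfLinear R (ModuleCat.of R Y) (add_comm 1 i)

theorem extMap_extMap (f : A →ₗ[R] B) (g : B →ₗ[R] C) (i : ℕ) (x : ExtGroup R C Y i) :
    extMap f Y i (extMap g Y i x) = extMap (g ∘ₗ f) Y i x := by
  change (Abelian.Ext.mk₀ (ModuleCat.ofHom f)).comp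
    ((Abelian.Ext.mk₀ (ModuleCat.ofHom g)).comp x (zero_add i)) (zero_add i) =
    (Abelian.Ext.mk₀ (ModuleCat.ofHom (g ∘ₗ f))).comp x (zero_add i)
  rw [ModuleCat.ofHom_comp, ← Abelian.Ext.mk₀_comp_mk₀_assoc]

theorem extMap_id (i : ℕ) (x : ExtGroup R A Y i) : extMap LinearMap.id Y i x = x :=
  Abelian.Ext.mk₀_id_comp x

theorem extMap_smul (r : R) (i : ℕ) (x : ExtGroup R A Y i) :
    extMap (LinearMap.lsmul R A r) Y i x = r • x := by
  have h : ModuleCat.ofHom (LinearMap.lsmul R A r) = r • 𝟙 (ModuleCat.of R A) := by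
    ext; rfl
  change (Abelian.Ext.mk₀ (ModuleCat.ofHom (LinearMap.lsmul R A r))).comp x (zero_add i) = _
  rw [h, Abelian.Ext.mk₀_smul, Abelian.Ext.smul_comp, Abelian.Ext.mk₀_id_comp]

theorem extMap_zero (i : ℕ) (x : ExtGroup R B Y i) : extMap (0 : A →ₗ[R] B) Y i x = 0 := by
  change (Abelian.Ext.mk₀ (ModuleCat.ofHom (0 : A →ₗ[R] B))).comp x (zero_add i) = 0
  rw [ModuleCat.ofHom_zero, Abelian.Ext.mk₀_zero, Abelian.Ext.zero_comp]

theorem exact_extMap_extMap {f : A →ₗ[R] B} {g : B →ₗ[R] C} (h : IsShortExact f g)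
    (Y : Type) [AddCommGroup Y] [Module R Y] (i : ℕ) :
    Function.Exact (extMap g Y i) (extMap f Y i) := by
  intro x
  constructor
  · intro hx
    exact Abelian.Ext.contravariant_sequence_exact₂ h.complex_shortExact _ x hx
  · rintro ⟨y, rfl⟩
    rw [extMap_extMap, h.exact.linearMap_comp_eq_zero, extMap_zero]

theorem exact_extMap_extConn {f : A →ₗ[R] B} {g : B →ₗ[R] C} (h : IsShortExact f g)
    (Y : Type) [AddCommGroup Y] [Module R Y] (i : ℕ) :
    Function.Exact (extMap f Y i) (extConn h Y i) := by
  intro x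
  constructor
  · intro hx
    exact Abelian.Ext.contravariant_sequence_exact₁ h.complex_shortExact _ x (add_comm 1 i) hx
  · rintro ⟨y, rfl⟩
    exact ShortComplex.ShortExact.extClass_comp_assoc h.complex_shortExact (h := add_comm 1 i) y

theorem exact_extConn_extMap {f : A →ₗ[R] B} {g : B →ₗ[R] C} (h : IsShortExact f g)
    (Y : Type) [AddCommGroup Y] [Module R Y] (i : ℕ) :
    Function.Exact (extConn h Y i) (extMap g Y (i + 1)) := by
  intro x
  constructor
  · intro hx
    exact Abelian.Ext.contravariant_sequence_exact₃ h.complex_shortExact _ x hx (add_comm 1 i)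
  · rintro ⟨y, rfl⟩
    exact ShortComplex.ShortExact.comp_extClass_assoc h.complex_shortExact y (add_comm 1 i)

theorem extMap_zero_injective {g : B →ₗ[R] C} (hg : Function.Surjective g) :
    Function.Injective (extMap g Y 0) := by
  rw [← LinearMap.ker_eq_bot, LinearMap.ker_eq_bot']
  intro x hx
  have : Epi (ModuleCat.ofHom g) := (ModuleCat.epi_iff_surjective _).2 hg
  exact (Abelian.Ext.precomp_mk₀_injective_of_epi (ModuleCat.of R Y) (ModuleCat.ofHom g))
    (hx.trans (map_zero (extMap g Y 0)).symm)

theorem subsingleton_of_exact {f : A →ₗ[R] B} {g : B →ₗ[R] C} (h : Function.Exact f g)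
    [Subsingleton A] [Subsingleton C] : Subsingleton B := by
  refine subsingleton_of_forall_eq 0 fun b => ?_
  obtain ⟨a, rfl⟩ := (h b).1 (Subsingleton.elim _ _)
  rw [Subsingleton.elim a 0, map_zero]

theorem injective_of_exact {f : A →ₗ[R] B} {g : B →ₗ[R] C} (h : Function.Exact f g)
    [Subsingleton A] : Function.Injective g := by
  rw [← LinearMap.ker_eq_bot, LinearMap.ker_eq_bot']
  intro b hb
  obtain ⟨a, rfl⟩ := (h b).1 hb
  rw [Subsingleton.elim a 0, map_zero]

theorem surjective_of_exact {f : A →ₗ[R] B} {g : B →ₗ[R] C} (h : Function.Exact f g)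
    [Subsingleton C] : Function.Surjective f := fun b => (h b).1 (Subsingleton.elim _ _)

theorem subsingleton_extGroup_of_projective [Module.Projective R A] (i : ℕ) :
    Subsingleton (ExtGroup R A Y (i + 1)) := by
  have : Projective (ModuleCat.of R A) :=
    (IsProjective.iff_projective (R := R) A).1 inferInstance
  exact subsingleton_of_forall_eq 0 fun x => Abelian.Ext.eq_zero_of_projective x

/-- `ExtGroup` in degree zero is `Hom`. -/
noncomputable def extGroupZero (R A B : Type) [CommRing R] [AddCommGroup A] [Module R A]
    [AddCommGroup B] [Module R B] : ExtGroup R A B 0 ≃ₗ[R] (A →ₗ[R] B) :=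
  (Abelian.Ext.linearEquiv₀ (R := R)).trans (ModuleCat.homLinearEquiv (S := R))

theorem extGroupZero_extMap (f : A →ₗ[R] B) (x : ExtGroup R B Y 0) :
    extGroupZero R A Y (extMap f Y 0 x) = extGroupZero R B Y x ∘ₗ f := by
  obtain ⟨y, rfl⟩ := (extGroupZero R B Y).symm.surjective x
  have : extMap f Y 0 ((extGroupZero R B Y).symm y) =
      (extGroupZero R A Y).symm (y ∘ₗ f) := by
    exact Abelian.Ext.mk₀_comp_mk₀ _ _
  rw [this]
  simp

/-- `ExtGroup` is invariant under isomorphism in the first variable. -/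
noncomputable def extGroupCongr (e : A ≃ₗ[R] B) (Y : Type) [AddCommGroup Y] [Module R Y] (i : ℕ) :
    ExtGroup R B Y i ≃ₗ[R] ExtGroup R A Y i :=
  LinearEquiv.ofLinearMap (extMap e.toLinearMap Y i) (extMap e.symm.toLinearMap Y i)
    (by
      ext x
      simp only [LinearMap.comp_apply, extMap_extMap]
      rw [LinearEquiv.comp_coe, LinearEquiv.self_trans_symm, LinearEquiv.refl_toLinearMap,
        extMap_id]; rfl)
    (by
      ext x
      simp only [LinearMap.comp_apply, extMap_extMap]
      rw [LinearEquiv.comp_coe, LinearEquiv.symm_trans_self, LinearEquiv.refl_toLinearMap,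
        extMap_id]; rfl)

theorem subsingleton_extGroup_of_subsingleton [Subsingleton A] (i : ℕ) :
    Subsingleton (ExtGroup R A Y i) := by
  refine subsingleton_of_forall_eq 0 fun x => ?_
  rw [← extMap_id i x, Subsingleton.elim (LinearMap.id : A →ₗ[R] A) 0, extMap_zero]

end ExtSequences

section Depth

variable {R : Type} [CommRing R]
variable {A B C X : Type} [AddCommGroup A] [Module R A] [AddCommGroup B] [Module R B]
  [AddCommGroup C] [Module R C] [AddCommGroup X] [Module R X]

section Covariant

variable {f : A →ₗ[R] B} {g : B →ₗ[R] C}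

theorem IsShortExact.subsingleton_ext_middle (h : IsShortExact f g) (i : ℕ)
    (hA : Subsingleton (ExtGroup R X A i)) (hC : Subsingleton (ExtGroup R X C i)) :
    Subsingleton (ExtGroup R X B i) := by
  refine subsingleton_of_forall_eq 0 fun x => ?_
  obtain ⟨y, rfl⟩ := Abelian.Ext.covariant_sequence_exact₂ _ h.complex_shortExact x
    (Subsingleton.elim (α := ExtGroup R X C i) _ _)
  rw [show y = 0 from Subsingleton.elim (α := ExtGroup R X A i) _ _, Abelian.Ext.zero_comp]; rfl

theorem IsShortExact.subsingleton_ext_left (h : IsShortExact f g) (i : ℕ)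
    (hC : Subsingleton (ExtGroup R X C i)) (hB : Subsingleton (ExtGroup R X B (i + 1))) :
    Subsingleton (ExtGroup R X A (i + 1)) := by
  refine subsingleton_of_forall_eq 0 fun x => ?_
  obtain ⟨y, rfl⟩ := Abelian.Ext.covariant_sequence_exact₁ _ h.complex_shortExact x
    (Subsingleton.elim (α := ExtGroup R X B (i + 1)) _ _) rfl
  rw [show y = 0 from Subsingleton.elim (α := ExtGroup R X C i) _ _, Abelian.Ext.zero_comp]; rfl

theorem IsShortExact.subsingleton_ext_right (h : IsShortExact f g) (i : ℕ)
    (hB : Subsingleton (ExtGroup R X B i)) (hA : Subsingleton (ExtGroup R X A (i + 1))) :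
    Subsingleton (ExtGroup R X C i) := by
  refine subsingleton_of_forall_eq 0 fun x => ?_
  obtain ⟨y, rfl⟩ := Abelian.Ext.covariant_sequence_exact₃ _ h.complex_shortExact x rfl
    (Subsingleton.elim (α := ExtGroup R X A (i + 1)) _ _)
  rw [show y = 0 from Subsingleton.elim (α := ExtGroup R X B i) _ _, Abelian.Ext.zero_comp]; rfl

theorem subsingleton_ext_zero_of_injective (hf : Function.Injective f)
    (hB : Subsingleton (ExtGroup R X B 0)) : Subsingleton (ExtGroup R X A 0) := by
  have : Subsingleton (X →ₗ[R] B) := (extGroupZero R X B).symm.toEquiv.subsingleton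
  have : Subsingleton (X →ₗ[R] A) := by
    refine subsingleton_of_forall_eq 0 fun φ => ?_
    ext x
    apply hf
    simpa using LinearMap.congr_fun (Subsingleton.elim (f ∘ₗ φ) 0) x
  exact (extGroupZero R X A).toEquiv.subsingleton

theorem subsingleton_ext_of_subsingleton_right [Subsingleton B] (i : ℕ) :
    Subsingleton (ExtGroup R X B i) := by
  refine subsingleton_of_forall_eq 0 fun x => ?_
  have h : (0 : ModuleCat.of R B ⟶ ModuleCat.of R B) = 𝟙 _ := by
    ext b; exact Subsingleton.elim (α := B) _ _
  rw [← Abelian.Ext.comp_mk₀_id x, ← h, Abelian.Ext.mk₀_zero, Abelian.Ext.comp_zero]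

end Covariant

variable [IsLocalRing R]

/-- `depth M ≥ n`, in terms of the vanishing of `Ext^i(k, M)` for `i < n`. -/
def DepthGE (R : Type) [CommRing R] [IsLocalRing R] (n : ℕ) (M : Type) [AddCommGroup M]
    [Module R M] : Prop :=
  ∀ i < n, Subsingleton (ExtGroup R (ResidueField R) M i)

theorem DepthGE.mono {m n : ℕ} (h : DepthGE R n A) (hmn : m ≤ n) : DepthGE R m A :=
  fun i hi => h i (by lia)

theorem depthGE_zero : DepthGE R 0 A := fun i hi => absurd hi (by lia)

theorem depthGE_of_subsingleton [Subsingleton A] (n : ℕ) : DepthGE R n A :=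
  fun i _ => subsingleton_ext_of_subsingleton_right i

theorem DepthGE.middle {f : A →ₗ[R] B} {g : B →ₗ[R] C} (h : IsShortExact f g) {n : ℕ}
    (hA : DepthGE R n A) (hC : DepthGE R n C) : DepthGE R n B :=
  fun i hi => h.subsingleton_ext_middle i (hA i hi) (hC i hi)

theorem DepthGE.left {f : A →ₗ[R] B} {g : B →ₗ[R] C} (h : IsShortExact f g) {n : ℕ}
    (hB : DepthGE R (n + 1) B) (hC : DepthGE R n C) : DepthGE R (n + 1) A := by
  rintro (_ | i) hi
  · exact subsingleton_ext_zero_of_injective h.inj (hB 0 hi)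
  · exact h.subsingleton_ext_left i (hC i (by lia)) (hB _ hi)

theorem DepthGE.left' {f : A →ₗ[R] B} {g : B →ₗ[R] C} (h : IsShortExact f g) {n : ℕ}
    (hB : DepthGE R n B) (hC : DepthGE R (n - 1) C) : DepthGE R n A := by
  cases n with
  | zero => exact depthGE_zero
  | succ n => exact hB.left h hC

theorem DepthGE.right {f : A →ₗ[R] B} {g : B →ₗ[R] C} (h : IsShortExact f g) {n : ℕ}
    (hA : DepthGE R (n + 1) A) (hB : DepthGE R n B) : DepthGE R n C :=
  fun i hi => h.subsingleton_ext_right i (hB i hi) (hA _ (by lia))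

theorem DepthGE.of_injective {n : ℕ} {f : A →ₗ[R] B} (hf : Function.Injective f) (hn : n ≤ 1)
    (hB : DepthGE R n B) : DepthGE R n A := by
  intro i hi
  obtain rfl : i = 0 := by lia
  exact subsingleton_ext_zero_of_injective hf (hB 0 hi)

theorem DepthGE.congr (e : A ≃ₗ[R] B) {n : ℕ} (h : DepthGE R n A) : DepthGE R n B := by
  have hs : IsShortExact e.toLinearMap (0 : B →ₗ[R] PUnit.{1}) := by
    refine ⟨e.injective, fun b => ?_, fun x => ⟨0, rfl⟩⟩
    simp
  exact h.middle hs (depthGE_of_subsingleton n)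

theorem DepthGE.prod {n : ℕ} (hA : DepthGE R n A) (hB : DepthGE R n B) :
    DepthGE R n (A × B) :=
  hA.middle (f := LinearMap.inl R A B) (g := LinearMap.snd R A B)
    ⟨LinearMap.inl_injective, Function.Exact.inl_snd, LinearMap.snd_surjective⟩ hB

theorem DepthGE.pi {n : ℕ} (h : DepthGE R n R) (m : ℕ) : DepthGE R n (Fin m → R) := by
  induction m with
  | zero => exact depthGE_of_subsingleton n
  | succ m ih => exact (h.prod ih).congr (Fin.consLinearEquiv R fun _ : Fin (m + 1) => R)

theorem DepthGE.free {n : ℕ} (h : DepthGE R n R) (F : Type) [AddCommGroup F] [Module R F]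
    [Module.Free R F] [Module.Finite R F] : DepthGE R n F :=
  (h.pi _).congr (Module.finBasis R F).equivFun.symm

theorem exists_isSMulRegular [IsNoetherianRing R] [Module.Finite R A] {n : ℕ}
    (h : DepthGE R (n + 1) A) : ∃ x ∈ maximalIdeal R, IsSMulRegular A x := by
  have : Subsingleton (ResidueField R →ₗ[R] A) :=
    (have := h 0 (by lia); (extGroupZero R (ResidueField R) A).symm.toEquiv.subsingleton)
  obtain ⟨x, hx, hreg⟩ := IsSMulRegular.subsingleton_linearMap_iff.1 this
  exact ⟨x, by rwa [show Module.annihilator R (ResidueField R) = maximalIdeal R from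
    Ideal.annihilator_quotient] at hx, hreg⟩

end Depth

section Comparison

variable {R : Type} [CommRing R]

theorem extMod_subsingleton_iff_cocycle {X Y : ModuleCat.{0} R} (P : ProjectiveResolution X)
    (p n : ℕ) (hp : (ComplexShape.up ℕ).prev n = p) :
    Subsingleton (((Ext R (ModuleCat R) n).obj (op X)).obj Y) ↔
      ∀ f : P.complex.X n ⟶ Y, P.complex.d (n + 1) n ≫ f = 0 →
        ∃ g, P.complex.d n p ≫ g = f := by
  rw [← ModuleCat.isZero_iff_subsingleton, (P.isoExt (R := R) n Y).isZero_iff,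
    ← HomologicalComplex.exactAt_iff_isZero_homology,
    HomologicalComplex.exactAt_iff' _ p n (n + 1) hp (by simp),
    ShortComplex.moduleCat_exact_iff]
  rfl

theorem extMod_subsingleton_iff (A B : Type) [AddCommGroup A] [Module R A] [AddCommGroup B]
    [Module R B] (n : ℕ) :
    Subsingleton (extMod R A B n) ↔ Subsingleton (ExtGroup R A B n) := by
  let P := projectiveResolution (ModuleCat.of R A)
  cases n with
  | zero =>
    rw [(extGroupZero R A B).toEquiv.subsingleton_congr,
      ← (ModuleCat.homEquiv (M := ModuleCat.of R A) (N := ModuleCat.of R B)).subsingleton_congr]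
    refine (extMod_subsingleton_iff_cocycle P 0 0 (by simp)).trans ⟨fun h => ?_, fun h f hf => ?_⟩
    · refine subsingleton_of_forall_eq 0 fun φ => ?_
      obtain ⟨g, hg⟩ := h (P.π.f 0 ≫ φ)
        ((P.complex_d_comp_π_f_zero_assoc φ).trans Limits.zero_comp)
      rw [P.complex.shape 0 0 (by simp), Limits.zero_comp] at hg
      exact (cancel_epi (P.π.f 0)).1 (hg.symm.trans Limits.comp_zero.symm)
    · let φ : ModuleCat.of R A ⟶ ModuleCat.of R B :=
        P.isColimitCokernelCofork.desc (Limits.CokernelCofork.ofπ f hf)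
      have hφ : P.π.f 0 ≫ φ = f :=
        P.isColimitCokernelCofork.fac (Limits.CokernelCofork.ofπ f hf)
          Limits.WalkingParallelPair.one
      refine ⟨0, ?_⟩
      have hφ0 : φ = 0 := Subsingleton.elim _ _
      rw [← hφ, hφ0, Limits.comp_zero]
      exact Limits.comp_zero.symm
  | succ n =>
    refine (extMod_subsingleton_iff_cocycle P n (n + 1) (by simp)).trans
      ⟨fun h => ?_, fun h f hf => ?_⟩
    · refine subsingleton_of_forall_eq 0 fun x => ?_
      obtain ⟨f, hf, rfl⟩ := P.extMk_surjective x (n + 2) rfl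
      exact (P.extMk_eq_zero_iff f _ rfl hf n rfl).2 (h f hf)
    · exact (P.extMk_eq_zero_iff f _ rfl hf n rfl).1 (Subsingleton.elim (α := ExtGroup R A B _) _ _)

variable [IsLocalRing R]

theorem le_rdepth_iff (M : Type) [AddCommGroup M] [Module R M] (n : ℕ) :
    (n : ℕ∞) ≤ rdepth R M ↔ DepthGE R n M := by
  rw [rdepth, le_sInf_iff]
  constructor
  · intro h i hi
    rw [← extMod_subsingleton_iff]
    by_contra hc
    have := h i ⟨i, not_subsingleton_iff_nontrivial.1 hc, rfl⟩
    exact absurd (Nat.cast_le.1 this) (by lia)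
  · rintro h _ ⟨i, hi, rfl⟩
    by_contra hc
    have h1 := h i (by simpa using hc)
    rw [← extMod_subsingleton_iff] at h1
    exact not_subsingleton _ h1

end Comparison

section Dimension

open scoped Pointwise

variable {R : Type} [CommRing R]
variable {A B C : Type} [AddCommGroup A] [Module R A] [AddCommGroup B] [Module R B]
  [AddCommGroup C] [Module R C]

/-- `dim M < n`. -/
def DimLT (R : Type) [CommRing R] (n : ℕ) (M : Type) [AddCommGroup M] [Module R M] : Prop :=
  Module.supportDim R M < (n : ℕ)

theorem dimLT_zero_iff : DimLT R 0 A ↔ Subsingleton A := by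
  rw [← Module.supportDim_eq_bot_iff_subsingleton R, DimLT]
  constructor
  · intro h
    by_contra hc
    exact absurd (Order.krullDim_nonneg_iff.2 (Order.krullDim_ne_bot_iff.1 hc)) (not_le.2 h)
  · intro h
    rw [h]
    exact WithBot.bot_lt_coe _

theorem DimLT.mono {m n : ℕ} (h : DimLT R m A) (hmn : m ≤ n) : DimLT R n A :=
  lt_of_lt_of_le h (by exact_mod_cast hmn)

theorem DimLT.of_injective {n : ℕ} {f : A →ₗ[R] B} (hf : Function.Injective f)
    (h : DimLT R n B) : DimLT R n A :=
  (Module.supportDim_le_of_injective f hf).trans_lt h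

theorem DimLT.of_surjective {n : ℕ} {f : A →ₗ[R] B} (hf : Function.Surjective f)
    (h : DimLT R n A) : DimLT R n B :=
  (Module.supportDim_le_of_surjective f hf).trans_lt h

theorem DimLT.congr (e : A ≃ₗ[R] B) {n : ℕ} (h : DimLT R n A) : DimLT R n B :=
  h.of_injective e.symm.injective

theorem DimLT.middle {f : A →ₗ[R] B} {g : B →ₗ[R] C} (h : IsShortExact f g) {n : ℕ}
    (hA : DimLT R n A) (hC : DimLT R n C) : DimLT R n B := by
  by_contra hc
  obtain ⟨l, hl⟩ := Order.le_krullDim_iff.1 (not_lt.1 hc)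
  have key : ∀ (S : Set (PrimeSpectrum R)), IsUpperSet S → (l.head : PrimeSpectrum R) ∈ S →
      (n : ℕ) ≤ Order.krullDim S := by
    intro S hS h0
    refine Order.le_krullDim_iff.2 ⟨⟨l.length, fun i => ⟨l i, hS (l.head_le i) h0⟩, ?_⟩, hl⟩
    exact fun i => l.step i
  rcases (Module.support_of_exact h.exact h.inj h.surj).subset l.head.2 with hmem | hmem
  · exact absurd hA (not_lt.2 (key _ (fun _ _ hab ha => Module.mem_support_mono hab ha) hmem))
  · exact absurd hC (not_lt.2 (key _ (fun _ _ hab ha => Module.mem_support_mono hab ha) hmem))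

theorem DimLT.of_exact {f : A →ₗ[R] B} {g : B →ₗ[R] C} (h : Function.Exact f g) {n : ℕ}
    (hA : DimLT R n A) (hC : DimLT R n C) : DimLT R n B := by
  refine DimLT.middle (IsShortExact.of_rangeRestrict g) ?_
    (hC.of_injective (Submodule.subtype_injective _))
  rw [h.linearMap_ker_eq]
  exact hA.of_surjective f.surjective_rangeRestrict

theorem isShortExact_lsmul {x : R} (hx : IsSMulRegular A x) :
    IsShortExact (LinearMap.lsmul R A x) (Submodule.mkQ (x • (⊤ : Submodule R A))) := by
  refine ⟨hx, ?_, Submodule.mkQ_surjective _⟩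
  rw [LinearMap.exact_iff, Submodule.ker_mkQ]
  ext a
  rw [Submodule.mem_smul_pointwise_iff_exists]
  simp

theorem IsShortExact.of_quotSMulTop_surjective {x : R} {g : A →ₗ[R] B}
    (hg : Function.Exact (LinearMap.lsmul R A x) g) (hs : Function.Surjective g) :
    Nonempty (QuotSMulTop x A ≃ₗ[R] B) := by
  have hk : x • (⊤ : Submodule R A) = LinearMap.ker g := by
    rw [hg.linearMap_ker_eq]
    ext a
    rw [Submodule.mem_smul_pointwise_iff_exists]
    simp
  exact ⟨(Submodule.quotEquivOfEq _ _ hk).trans (g.quotKerEquivOfSurjective hs)⟩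

variable [IsLocalRing R]

theorem subsingleton_of_quotSMulTop [Module.Finite R A] {x : R} (hx : x ∈ maximalIdeal R)
    (h : Subsingleton (QuotSMulTop x A)) : Subsingleton A := by
  by_contra hc
  rw [not_subsingleton_iff_nontrivial] at hc
  have := Submodule.top_ne_pointwise_smul_of_mem_jacobson_annihilator (M := A) (r := x)
    (IsLocalRing.maximalIdeal_le_jacobson _ hx)
  exact this (Submodule.Quotient.subsingleton_iff.1 h).symm

theorem subsingleton_of_lsmul_surjective [Module.Finite R A] {x : R} (hx : x ∈ maximalIdeal R)
    (h : Function.Surjective (LinearMap.lsmul R A x)) : Subsingleton A := by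
  refine subsingleton_of_quotSMulTop hx (Submodule.Quotient.subsingleton_iff.2 ?_)
  rw [eq_top_iff]
  rintro a -
  obtain ⟨b, rfl⟩ := h a
  exact Submodule.smul_mem_pointwise_smul _ _ _ trivial

variable [IsNoetherianRing R]

theorem DimLT.quotSMulTop [Module.Finite R A] {x : R} (hx : x ∈ maximalIdeal R)
    (hreg : IsSMulRegular A x) {n : ℕ} (h : DimLT R n A) : DimLT R (n - 1) (QuotSMulTop x A) := by
  cases n with
  | zero =>
    rw [dimLT_zero_iff] at h
    exact dimLT_zero_iff.2 (Submodule.mkQ_surjective _).subsingleton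
  | succ n =>
    rw [DimLT, ← Module.supportDim_quotSMulTop_succ_eq_supportDim hreg hx] at h
    rw [Nat.cast_succ] at h
    rw [DimLT]
    by_contra hc
    exact absurd h (not_lt.2 (add_le_add_left (not_lt.1 hc) 1))

theorem DimLT.of_quotSMulTop [Module.Finite R A] {x : R} (hx : x ∈ maximalIdeal R)
    {n : ℕ} (h : DimLT R (n - 1) (QuotSMulTop x A)) (hn : n = 0 → Subsingleton A) :
    DimLT R n A := by
  cases n with
  | zero => exact dimLT_zero_iff.2 (hn rfl)
  | succ n =>
    refine (Module.supportDim_le_supportDim_quotSMulTop_succ hx).trans_lt ?_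
    cases hq : Module.supportDim R (QuotSMulTop x A) with
    | bot => exact WithBot.bot_lt_coe _
    | coe q =>
      rw [DimLT, hq] at h
      have h1 : q < (n : ℕ∞) := WithBot.coe_lt_coe.1 h
      have h2 : q + 1 < ((n + 1 : ℕ) : ℕ∞) := by
        lift q to ℕ using h1.ne_top
        exact_mod_cast Nat.add_lt_add_right (by exact_mod_cast h1) 1
      exact WithBot.coe_lt_coe.2 h2

/-- Dévissage for finite modules over a Noetherian local ring: to prove a property it suffices to
check it on zero and on the residue field, for extensions, and to lift it from `M / xM`
for `x ∈ 𝔪` regular on `M`. -/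
theorem finite_induction
    {P : ∀ (M : Type) [AddCommGroup M] [Module R M] [Module.Finite R M], Prop}
    (h0 : ∀ (M : Type) [AddCommGroup M] [Module R M] [Module.Finite R M] [Subsingleton M], P M)
    (hk : ∀ (M : Type) [AddCommGroup M] [Module R M] [Module.Finite R M]
      (_ : M ≃ₗ[R] ResidueField R), P M)
    (hses : ∀ (A B C : Type) [AddCommGroup A] [Module R A] [Module.Finite R A]
      [AddCommGroup B] [Module R B] [Module.Finite R B] [AddCommGroup C] [Module R C]
      [Module.Finite R C] (f : A →ₗ[R] B) (g : B →ₗ[R] C), IsShortExact f g →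
      P A → P C → P B)
    (hreg : ∀ (M : Type) [AddCommGroup M] [Module R M] [Module.Finite R M] (x : R),
      x ∈ maximalIdeal R → IsSMulRegular M x → P (QuotSMulTop x M) → P M)
    (M : Type) [AddCommGroup M] [Module R M] [Module.Finite R M] : P M := by
  have key : ∀ p : PrimeSpectrum R, ∀ (M : Type) [AddCommGroup M] [Module R M]
      [Module.Finite R M] (_ : M ≃ₗ[R] R ⧸ p.asIdeal), P M := by
    have : WellFoundedGT (PrimeSpectrum R) :=
      StrictMono.wellFoundedGT (f := PrimeSpectrum.asIdeal) fun _ _ h => h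
    intro p
    induction p using WellFoundedGT.induction with
    | ind p ih =>
    intro M _ _ _ e
    by_cases hp : p.asIdeal = maximalIdeal R
    · exact hk M (e.trans (Submodule.quotEquivOfEq _ _ hp))
    obtain ⟨x, hx, hxp⟩ : ∃ x ∈ maximalIdeal R, x ∉ p.asIdeal := by
      by_contra! hc
      exact hp (le_antisymm (le_maximalIdeal p.2.ne_top) hc)
    have hmul : ∀ (N : Type) [AddCommGroup N] [Module R N] [Module.Finite R N],
        (p.asIdeal ≤ Module.annihilator R N ∧ x ∈ Module.annihilator R N) → P N := by
      intro N _ _ hN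
      refine IsNoetherianRing.induction_on_isQuotientEquivQuotientPrime R hN
        (motive := fun N _ _ _ =>
          (p.asIdeal ≤ Module.annihilator R N ∧ x ∈ Module.annihilator R N) → P N) ?_ ?_ ?_
      · exact fun N _ _ _ _ _ => h0 N
      · intro N _ _ _ q e' ⟨h1, h2⟩
        rw [e'.annihilator_eq, Ideal.annihilator_quotient] at h1 h2
        refine ih q (lt_of_le_of_ne h1 ?_) N e'
        rintro rfl
        exact hxp h2
      · intro N₁ _ _ _ N₂ _ _ _ N₃ _ _ _ f g hf hg hfg h1 h3 ⟨hp2, hx2⟩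
        refine hses N₁ N₂ N₃ f g ⟨hf, hfg, hg⟩ (h1 ?_) (h3 ?_)
        · exact ⟨hp2.trans (f.annihilator_le_of_injective hf),
            f.annihilator_le_of_injective hf hx2⟩
        · exact ⟨hp2.trans (g.annihilator_le_of_surjective hg),
            g.annihilator_le_of_surjective hg hx2⟩
    have hann : Module.annihilator R M = p.asIdeal := by
      rw [e.annihilator_eq, Ideal.annihilator_quotient]
    refine hreg M x hx ?_ (hmul _ ⟨?_, ?_⟩)
    · intro a b hab
      apply e.injective
      have h1 : x • (e a - e b) = 0 := by
        rw [smul_sub, ← map_smul, ← map_smul]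
        exact sub_eq_zero.2 (congrArg e hab)
      obtain ⟨r, hr⟩ := Ideal.Quotient.mk_surjective (e a - e b)
      rw [← hr, ← Ideal.Quotient.mk_eq_mk, ← Submodule.Quotient.mk_smul,
        Submodule.Quotient.mk_eq_zero] at h1
      have h2 := (p.2.mem_or_mem h1).resolve_left hxp
      rw [← sub_eq_zero, ← hr]
      exact Ideal.Quotient.eq_zero_iff_mem.2 h2
    · rw [← hann]
      exact LinearMap.annihilator_le_of_surjective _ (Submodule.mkQ_surjective _)
    · rw [Module.mem_annihilator]
      intro m
      obtain ⟨a, rfl⟩ := Submodule.mkQ_surjective _ m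
      rw [← map_smul]
      exact (Submodule.Quotient.mk_eq_zero _).2 (Submodule.smul_mem_pointwise_smul _ _ _ trivial)
  refine IsNoetherianRing.induction_on_isQuotientEquivQuotientPrime R
    (inferInstanceAs (Module.Finite R M)) (motive := fun N _ _ _ => P N) ?_ ?_ ?_
  · exact fun N _ _ _ _ => h0 N
  · exact fun N _ _ _ q e => key q N e
  · exact fun N₁ _ _ _ N₂ _ _ _ N₃ _ _ _ f g hf hg hfg h1 h3 =>
      hses N₁ N₂ N₃ f g ⟨hf, hfg, hg⟩ h1 h3

end Dimension

section Gorenstein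

open scoped Pointwise

variable {R : Type} [CommRing R]
variable {A B M : Type} [AddCommGroup A] [Module R A] [AddCommGroup B] [Module R B]
  [AddCommGroup M] [Module R M] [Module.Finite R M]

theorem extMap_lsmul (A Y : Type) [AddCommGroup A] [Module R A] [AddCommGroup Y] [Module R Y]
    (x : R) (i : ℕ) :
    extMap (LinearMap.lsmul R A x) Y i = LinearMap.lsmul R (ExtGroup R A Y i) x :=
  LinearMap.ext fun y => extMap_smul x i y

theorem exact_lsmul_extConn (Y : Type) [AddCommGroup Y] [Module R Y] {x : R}
    (hreg : IsSMulRegular A x) (i : ℕ) :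
    Function.Exact (LinearMap.lsmul R (ExtGroup R A Y i) x)
      (extConn (isShortExact_lsmul hreg) Y i) := by
  rw [← extMap_lsmul]
  exact exact_extMap_extConn _ Y i

variable [IsLocalRing R]

theorem DepthGE.quotSMulTop {x : R} (hreg : IsSMulRegular A x) {n : ℕ} (h : DepthGE R (n + 1) A) :
    DepthGE R n (QuotSMulTop x A) :=
  h.right (isShortExact_lsmul hreg) (h.mono (by lia))

theorem smul_residueField_eq_zero {x : R} (hx : x ∈ maximalIdeal R) (y : ResidueField R) :
    x • y = 0 := by
  rw [Algebra.smul_def, show algebraMap R (ResidueField R) x = 0 from (residue_eq_zero_iff x).2 hx,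
    zero_mul]

theorem lsmul_residueField_eq_zero {x : R} (hx : x ∈ maximalIdeal R) :
    LinearMap.lsmul R (ResidueField R) x = 0 :=
  LinearMap.ext fun y => smul_residueField_eq_zero hx y

theorem DepthGE.of_lsmul {x : R} (hx : x ∈ maximalIdeal R) {g : A →ₗ[R] B}
    (h : IsShortExact (LinearMap.lsmul R A x) g) {t : ℕ} (hB : DepthGE R t B) :
    DepthGE R (t + 1) A := by
  have hzero : ∀ {i : ℕ} (y : ExtGroup R (ResidueField R) A i),
      y.comp (Abelian.Ext.mk₀ (ModuleCat.ofHom (LinearMap.lsmul R A x))) (add_zero i) = 0 := by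
    intro i y
    have h1 : ModuleCat.ofHom (LinearMap.lsmul R A x) = x • 𝟙 (ModuleCat.of R A) := by
      ext; rfl
    rw [h1, Abelian.Ext.mk₀_smul, Abelian.Ext.comp_smul, Abelian.Ext.comp_mk₀_id,
      ← extMap_smul, lsmul_residueField_eq_zero hx, extMap_zero]
  rintro (_ | i) hi
  · have : Subsingleton (ResidueField R →ₗ[R] A) := by
      refine subsingleton_of_forall_eq 0 fun φ => ?_
      refine LinearMap.ext fun y => h.inj ?_
      change x • φ y = x • 0
      rw [← map_smul, smul_residueField_eq_zero hx, map_zero, smul_zero]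
    exact (extGroupZero R (ResidueField R) A).toEquiv.subsingleton
  · refine subsingleton_of_forall_eq 0 fun y => ?_
    obtain ⟨z, rfl⟩ := Abelian.Ext.covariant_sequence_exact₁ _ h.complex_shortExact y
      (hzero y) rfl
    have := hB i (by lia)
    rw [show z = 0 from Subsingleton.elim (α := ExtGroup R (ResidueField R) B i) _ _,
      Abelian.Ext.zero_comp]; rfl

variable [IsNoetherianRing R]

theorem subsingleton_ext_of_quotSMulTop {x : R} (hx : x ∈ maximalIdeal R)
    (hreg : IsSMulRegular M x) {i : ℕ} (h : Subsingleton (ExtGroup R (QuotSMulTop x M) R (i + 1))) :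
    Subsingleton (ExtGroup R M R i) :=
  subsingleton_of_lsmul_surjective hx (surjective_of_exact (exact_lsmul_extConn R hreg i))

/-- `Ext^i(N, R)` has dimension at most `d - i`. -/
theorem dimLT_ext {d : ℕ} (hG : ∀ i, i ≠ d → Subsingleton (ExtGroup R (ResidueField R) R i))
    (M : Type) [AddCommGroup M] [Module R M] [Module.Finite R M] (i : ℕ) :
    DimLT R (d + 1 - i) (ExtGroup R M R i) := by
  revert i
  refine @finite_induction R _ _ _
    (fun M _ _ _ => ∀ i, DimLT R (d + 1 - i) (ExtGroup R M R i)) ?_ ?_ ?_ ?_ M _ _ _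
  · intro M _ _ _ _ i
    exact (dimLT_zero_iff.2 (subsingleton_extGroup_of_subsingleton i)).mono (by lia)
  · intro M _ _ _ e i
    refine DimLT.congr (extGroupCongr e R i) ?_
    by_cases hi : i = d
    · subst hi
      have hle : maximalIdeal R ≤ Module.annihilator R (ExtGroup R (ResidueField R) R i) := by
        intro r hr
        rw [Module.mem_annihilator]
        intro y
        rw [← extMap_smul, lsmul_residueField_eq_zero hr, extMap_zero]
      refine lt_of_le_of_lt (b := 0) ?_ (by simp)
      have : Ring.KrullDimLE 0 (R ⧸ maximalIdeal R) :=
        inferInstanceAs (Ring.KrullDimLE 0 (ResidueField R))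
      calc Module.supportDim R (ExtGroup R (ResidueField R) R i)
          = ringKrullDim (R ⧸ Module.annihilator R (ExtGroup R (ResidueField R) R i)) :=
            Module.supportDim_eq_ringKrullDim_quotient_annihilator _ _
        _ ≤ ringKrullDim (R ⧸ maximalIdeal R) :=
            ringKrullDim_le_of_surjective (Ideal.Quotient.factor hle)
              (Ideal.Quotient.factor_surjective hle)
        _ ≤ 0 := (Order.krullDimLE_iff 0 _).1 this
    · exact (dimLT_zero_iff.2 (hG i hi)).mono (by lia)
  · intro A B C _ _ _ _ _ _ _ _ _ f g h hA hC i
    exact DimLT.of_exact (exact_extMap_extMap h R i) (hC i) (hA i)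
  · intro M _ _ _ x hx hreg hM i
    have h1 := exact_lsmul_extConn R hreg i
    refine DimLT.of_quotSMulTop hx ?_ fun hi => ?_
    · have h2 : DimLT R (d + 1 - (i + 1))
          (LinearMap.range (extConn (isShortExact_lsmul hreg) R i)) :=
        (hM (i + 1)).of_injective (Submodule.subtype_injective _)
      obtain ⟨e⟩ := IsShortExact.of_quotSMulTop_surjective
        (g := (extConn (isShortExact_lsmul hreg) R i).rangeRestrict)
        (by
          intro y
          rw [← h1 y, ← Subtype.coe_inj]
          rfl)
        (LinearMap.surjective_rangeRestrict _)
      exact (h2.congr e.symm).mono (by lia)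
    · refine subsingleton_ext_of_quotSMulTop hx hreg (dimLT_zero_iff.1 ((hM (i + 1)).mono ?_))
      lia

theorem subsingleton_ext_of_dimLT {d : ℕ}
    (hG : ∀ i, i ≠ d → Subsingleton (ExtGroup R (ResidueField R) R i))
    (M : Type) [AddCommGroup M] [Module R M] [Module.Finite R M] {i : ℕ}
    (h : DimLT R (d - i) M) : Subsingleton (ExtGroup R M R i) := by
  revert i
  refine @finite_induction R _ _ _ (fun M _ _ _ => ∀ {i : ℕ}, DimLT R (d - i) M →
    Subsingleton (ExtGroup R M R i)) ?_ ?_ ?_ ?_ M _ _ _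
  · exact fun M _ _ _ _ i _ => subsingleton_extGroup_of_subsingleton i
  · intro M _ _ _ e i hi
    have := hG i (by
      rintro rfl
      rw [Nat.sub_self, dimLT_zero_iff] at hi
      exact not_subsingleton _ e.symm.toEquiv.subsingleton)
    exact (extGroupCongr e R i).symm.toEquiv.subsingleton
  · intro A B C _ _ _ _ _ _ _ _ _ f g h hA hC i hi
    have := hA (hi.of_injective h.inj)
    have := hC (hi.of_surjective h.surj)
    exact subsingleton_of_exact (exact_extMap_extMap h R i)
  · intro M _ _ _ x hx hreg hM i hi
    refine subsingleton_ext_of_quotSMulTop hx hreg (hM ?_)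
    exact (hi.quotSMulTop hx hreg).mono (by lia)

theorem subsingleton_ext_of_depthGE {d : ℕ}
    (hG : ∀ i, i ≠ d → Subsingleton (ExtGroup R (ResidueField R) R i)) {t : ℕ}
    (M : Type) [AddCommGroup M] [Module R M] [Module.Finite R M]
    (h : DepthGE R t M) {i : ℕ} (hi : d < i + t) : Subsingleton (ExtGroup R M R i) := by
  induction t generalizing M i with
  | zero => exact dimLT_zero_iff.1 ((dimLT_ext hG M i).mono (by lia))
  | succ t ih =>
    obtain ⟨x, hx, hreg⟩ := exists_isSMulRegular h
    exact subsingleton_ext_of_quotSMulTop hx hreg (ih _ (h.quotSMulTop hreg) (by lia))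

theorem subsingleton_of_depthGE_of_dimLT {t : ℕ} (M : Type) [AddCommGroup M] [Module R M]
    [Module.Finite R M] (h : DepthGE R t M) (hd : DimLT R t M) : Subsingleton M := by
  induction t generalizing M with
  | zero => exact dimLT_zero_iff.1 hd
  | succ t ih =>
    obtain ⟨x, hx, hreg⟩ := exists_isSMulRegular h
    exact subsingleton_of_quotSMulTop hx (ih _ (h.quotSMulTop hreg) (hd.quotSMulTop hx hreg))

theorem subsingleton_ext_of_isCM {d : ℕ}
    (hG : ∀ i, i ≠ d → Subsingleton (ExtGroup R (ResidueField R) R i)) {t : ℕ}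
    (M : Type) [AddCommGroup M] [Module R M] [Module.Finite R M]
    (h : DepthGE R t M) (hd : DimLT R (t + 1) M) {i : ℕ} (hi : i + t ≠ d) :
    Subsingleton (ExtGroup R M R i) := by
  rcases lt_or_gt_of_ne hi with hi | hi
  · exact subsingleton_ext_of_dimLT hG M (hd.mono (by lia))
  · exact subsingleton_ext_of_depthGE hG M h hi

theorem depthGE_ext_of_isCM {d : ℕ}
    (hG : ∀ i, i ≠ d → Subsingleton (ExtGroup R (ResidueField R) R i)) {t i : ℕ}
    (M : Type) [AddCommGroup M] [Module R M] [Module.Finite R M]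
    (h : DepthGE R t M) (hd : DimLT R (t + 1) M) (hi : i + t = d) :
    DepthGE R t (ExtGroup R M R i) := by
  induction t generalizing M i with
  | zero => exact depthGE_zero
  | succ t ih =>
    obtain ⟨x, hx, hreg⟩ := exists_isSMulRegular h
    have hs := isShortExact_lsmul hreg
    have h1 := h.quotSMulTop hreg
    have h2 : DimLT R (t + 1) (QuotSMulTop x M) := hd.quotSMulTop hx hreg
    have := subsingleton_ext_of_isCM hG _ h1 h2 (i := i) (by lia)
    have := subsingleton_ext_of_isCM hG M h hd (i := i + 1) (by lia)
    have e1 := exact_extMap_extMap hs R i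
    have e3 := exact_extConn_extMap hs R i
    rw [extMap_lsmul] at e1
    exact DepthGE.of_lsmul hx ⟨injective_of_exact e1, exact_lsmul_extConn R hreg i,
      surjective_of_exact e3⟩ (ih _ h1 h2 (i := i + 1) (by lia))

end Gorenstein

section Filtrations

variable {R : Type} [CommRing R]
variable {A B C : Type} [AddCommGroup A] [Module R A] [AddCommGroup B] [Module R B]
  [AddCommGroup C] [Module R C]

/-- Vanishing of two consecutive terms on either side makes `extMap` bijective. -/
theorem extMap_bijective_of_left {f : A →ₗ[R] B} {g : B →ₗ[R] C} (h : IsShortExact f g) {i : ℕ}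
    (h0 : ∀ j, j + 1 = i → Subsingleton (ExtGroup R A R j))
    (h1 : Subsingleton (ExtGroup R A R i)) : Function.Bijective (extMap g R i) := by
  refine ⟨?_, surjective_of_exact (exact_extMap_extMap h R i)⟩
  cases i with
  | zero => exact extMap_zero_injective h.surj
  | succ i =>
    have := h0 i rfl
    exact injective_of_exact (exact_extConn_extMap h R i)

theorem extMap_bijective_of_right {f : A →ₗ[R] B} {g : B →ₗ[R] C} (h : IsShortExact f g) {i : ℕ}
    (h0 : Subsingleton (ExtGroup R C R i)) (h1 : Subsingleton (ExtGroup R C R (i + 1))) :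
    Function.Bijective (extMap f R i) :=
  ⟨injective_of_exact (exact_extMap_extMap h R i),
    surjective_of_exact (exact_extMap_extConn h R i)⟩

theorem extConn_bijective {f : A →ₗ[R] B} {g : B →ₗ[R] C} (h : IsShortExact f g) {i : ℕ}
    (h0 : Subsingleton (ExtGroup R B R i)) (h1 : Subsingleton (ExtGroup R B R (i + 1))) :
    Function.Bijective (extConn h R i) :=
  ⟨injective_of_exact (exact_extMap_extConn h R i),
    surjective_of_exact (exact_extConn_extMap h R i)⟩

variable [IsLocalRing R]

/-- All modules `Ext^i(M, R)` satisfy `depth Ext^i(M, R) ≥ d - i`. -/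
def SlidingDepth (R : Type) [CommRing R] [IsLocalRing R] (d : ℕ) (M : Type) [AddCommGroup M]
    [Module R M] : Prop :=
  ∀ i, DepthGE R (d - i) (ExtGroup R M R i)

theorem SlidingDepth.congr {d : ℕ} (e : A ≃ₗ[R] B) (h : SlidingDepth R d A) :
    SlidingDepth R d B :=
  fun i => (h i).congr (extGroupCongr e R i).symm

theorem slidingDepth_of_subsingleton [Subsingleton A] (d : ℕ) : SlidingDepth R d A := fun i =>
  have := subsingleton_extGroup_of_subsingleton (R := R) (A := A) (Y := R) i
  depthGE_of_subsingleton _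

theorem exists_dim_of_isCM {d : ℕ} (hdim : ringKrullDim R = (d : ℕ)) {N : Type} [AddCommGroup N]
    [Module R N] [Module.Finite R N] [Nontrivial N] (h : isCM R N) :
    ∃ t ≤ d, mdim R N = (t : ℕ) ∧ DepthGE R t N ∧ DimLT R (t + 1) N := by
  have h1 : mdim R N = Module.supportDim R N :=
    (Module.supportDim_eq_ringKrullDim_quotient_annihilator R N).symm
  have hle := hdim ▸ Module.supportDim_le_ringKrullDim R N
  have h0 : Module.supportDim R N ≠ ⊥ := fun hc =>
    not_subsingleton N ((Module.supportDim_eq_bot_iff_subsingleton R N).1 hc)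
  obtain ⟨t, ht⟩ : ∃ t : ℕ, Module.supportDim R N = (t : ℕ) := by
    generalize Module.supportDim R N = s at hle h0
    cases s with
    | bot => exact absurd rfl h0
    | coe s =>
      have hs : s ≤ (d : ℕ∞) := WithBot.coe_le_coe.1 hle
      lift s to ℕ using (hs.trans_lt (ENat.natCast_lt_top d)).ne
      exact ⟨s, rfl⟩
  refine ⟨t, by rw [ht] at hle; exact_mod_cast hle, h1.trans ht, (le_rdepth_iff N t).1 ?_, ?_⟩
  · rw [isCM, h1, ht] at h
    exact (WithBot.coe_le_coe.1 h.ge)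
  · rw [DimLT, ht]
    exact_mod_cast Nat.lt_succ_self t

variable [IsNoetherianRing R]

theorem SlidingDepth.middle {d t : ℕ}
    (hG : ∀ i, i ≠ d → Subsingleton (ExtGroup R (ResidueField R) R i)) [Module.Finite R A]
    [Module.Finite R B] [Module.Finite R C]
    {f : A →ₗ[R] B} {g : B →ₗ[R] C} (h : IsShortExact f g)
    (hA : SlidingDepth R d A) (hAd : DimLT R t A) (hC : DepthGE R t C) (hCd : DimLT R (t + 1) C) :
    SlidingDepth R d B := by
  intro i
  rcases lt_trichotomy (i + t) d with hi | hi | hi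
  · have := subsingleton_ext_of_dimLT hG B (i := i)
      (DimLT.middle h (hAd.mono (by lia)) (hCd.mono (by lia)))
    exact depthGE_of_subsingleton _
  · have h1 := extMap_bijective_of_left h (i := i)
      (fun j hj => subsingleton_ext_of_dimLT hG A (hAd.mono (by lia)))
      (subsingleton_ext_of_dimLT hG A (hAd.mono (by lia)))
    exact ((depthGE_ext_of_isCM hG C hC hCd hi).congr (LinearEquiv.ofBijective _ h1)).mono
      (by lia)
  · have h1 := extMap_bijective_of_right h (subsingleton_ext_of_depthGE hG C hC hi)
      (subsingleton_ext_of_depthGE hG C hC (i := i + 1) (by lia))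
    exact (hA i).congr (LinearEquiv.ofBijective _ h1).symm

theorem isCM_of_depthGE_of_dimLT {N : Type} [AddCommGroup N] [Module R N] [Module.Finite R N]
    [Nontrivial N] {t : ℕ} (h : DepthGE R t N) (hd : DimLT R (t + 1) N) :
    isCM R N ∧ mdim R N = (t : ℕ) := by
  have h1 : rdepth R N = (t : ℕ∞) := by
    refine le_antisymm (not_lt.1 fun hc => ?_) ((le_rdepth_iff N t).2 h)
    have h2 : DepthGE R (t + 1) N := by
      rw [← le_rdepth_iff]
      exact_mod_cast Order.add_one_le_of_lt hc
    exact not_subsingleton _ (subsingleton_of_depthGE_of_dimLT N h2 hd)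
  have h2 : mdim R N = (t : ℕ) := by
    rw [mdim, ← Module.supportDim_eq_ringKrullDim_quotient_annihilator]
    refine le_antisymm ?_ (not_lt.1 fun hc =>
      not_subsingleton _ (subsingleton_of_depthGE_of_dimLT N h hc))
    rw [DimLT] at hd
    generalize Module.supportDim R N = s at hd
    cases s with
    | bot => exact bot_le
    | coe s =>
      have hs : s < ((t + 1 : ℕ) : ℕ∞) := WithBot.coe_lt_coe.1 hd
      rw [Nat.cast_succ] at hs
      exact WithBot.coe_le_coe.2 (Order.le_of_lt_add_one hs)
  refine ⟨?_, h2⟩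
  rw [isCM, h1, h2]
  rfl

theorem slidingDepth_of_isSeqCM {d : ℕ} (hdim : ringKrullDim R = (d : ℕ))
    (hG : ∀ i, i ≠ d → Subsingleton (ExtGroup R (ResidueField R) R i)) (M : Type)
    [AddCommGroup M] [Module R M] [Module.Finite R M] (h : isSeqCM R M) : SlidingDepth R d M := by
  obtain ⟨r, Φ, h0, hlast, hmono, hCM, hlt⟩ := h
  have hnt : ∀ i : Fin r,
      Nontrivial (↥(Φ i.succ) ⧸ (Φ i.castSucc).comap (Φ i.succ).subtype) := by
    intro i
    rw [Submodule.Quotient.nontrivial_iff, Ne, Submodule.comap_subtype_eq_top]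
    exact (hmono i.castSucc_lt_succ).not_ge
  choose t _ ht hdep hdimt using fun i => exists_dim_of_isCM hdim (hCM i)
  have htm : ∀ i j, i < j → t i < t j := by
    intro i j hij
    have := hlt i j hij
    rw [ht, ht] at this
    exact_mod_cast this
  have key : ∀ i : Fin (r + 1), SlidingDepth R d (Φ i) ∧
      ∀ l : Fin r, i ≤ l.castSucc → DimLT R (t l) (Φ i) := by
    intro i
    induction i using Fin.induction with
    | zero =>
      have : Subsingleton (Φ 0) := by rw [h0]; infer_instance
      exact ⟨slidingDepth_of_subsingleton d,
        fun l _ => (dimLT_zero_iff.2 this).mono (Nat.zero_le _)⟩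
    | succ i ih =>
      have e := (Submodule.comapSubtypeEquivOfLe (hmono i.castSucc_lt_succ).le).symm
      have hs := IsShortExact.of_mkQ ((Φ i.castSucc).comap (Φ i.succ).subtype)
      have hA := (ih.2 i le_rfl).congr e
      refine ⟨(ih.1.congr e).middle hG hs hA (hdep i) (hdimt i), fun l hl => ?_⟩
      have hil : t i < t l := htm i l (Fin.succ_le_castSucc_iff.1 hl)
      exact (hA.mono hil.le).middle hs ((hdimt i).mono hil)
  have := (key (Fin.last r)).1
  rw [hlast] at this
  exact this.congr Submodule.topEquiv

end Filtrations

section Syzygies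

variable {R : Type} [CommRing R]
variable {F' F Z : Type} [AddCommGroup F'] [Module R F'] [AddCommGroup F] [Module R F]
  [AddCommGroup Z] [Module R Z]

theorem isShortExact_dualMap {q : F' →ₗ[R] F} {p : F →ₗ[R] Z} (hp : Function.Surjective p)
    (hqp : LinearMap.range q = LinearMap.ker p) :
    IsShortExact (C := LinearMap.range q.dualMap) p.dualMap q.dualMap.rangeRestrict := by
  refine ⟨LinearMap.dualMap_injective_of_surjective hp, fun φ => ?_,
    LinearMap.surjective_rangeRestrict _⟩
  rw [← Subtype.coe_inj]
  change q.dualMap φ = 0 ↔ _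
  rw [← LinearMap.mem_ker, LinearMap.ker_dualMap_eq_dualAnnihilator_range, hqp,
    ← LinearMap.range_dualMap_eq_dualAnnihilator_ker_of_surjective p hp]
  rfl

theorem IsShortExact.of_presentation {q : F' →ₗ[R] F} {p : F →ₗ[R] Z}
    (hp : Function.Surjective p) (hqp : LinearMap.range q = LinearMap.ker p) :
    IsShortExact (LinearMap.range q).subtype p := by
  refine ⟨Subtype.val_injective, ?_, hp⟩
  rw [LinearMap.exact_iff, Submodule.range_subtype, hqp]

/-- Dimension shifting along a presentation. -/
noncomputable def extShift [Module.Projective R F] {q : F' →ₗ[R] F} {p : F →ₗ[R] Z}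
    (hp : Function.Surjective p) (hqp : LinearMap.range q = LinearMap.ker p) (i : ℕ) :
    ExtGroup R (LinearMap.range q) R (i + 1) ≃ₗ[R] ExtGroup R Z R (i + 1 + 1) :=
  LinearEquiv.ofBijective (extConn (IsShortExact.of_presentation hp hqp) R (i + 1))
    (extConn_bijective _ (subsingleton_extGroup_of_projective i)
      (subsingleton_extGroup_of_projective (i + 1)))

/-- The image of `q*` is the kernel of the connecting map `(range q)* → Ext¹(Z, R)`. -/
theorem exists_isShortExact_ext_one [Module.Projective R F] {q : F' →ₗ[R] F} {p : F →ₗ[R] Z}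
    (hp : Function.Surjective p) (hqp : LinearMap.range q = LinearMap.ker p) :
    ∃ (j : LinearMap.range q.dualMap →ₗ[R] Module.Dual R (LinearMap.range q))
      (δ : Module.Dual R (LinearMap.range q) →ₗ[R] ExtGroup R Z R 1),
      IsShortExact (A := LinearMap.range q.dualMap) j δ ∧
      q.rangeRestrict.dualMap ∘ₗ j = (LinearMap.range q.dualMap).subtype := by
  set K := LinearMap.range q
  set q' : F' →ₗ[R] K := q.rangeRestrict
  have hinj : Function.Injective q'.dualMap :=
    LinearMap.dualMap_injective_of_surjective q.surjective_rangeRestrict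
  have hmap : LinearMap.range q.dualMap = (LinearMap.range K.subtype.dualMap).map q'.dualMap := by
    rw [← LinearMap.range_comp, LinearMap.dualMap_comp_dualMap]
    rfl
  let e : LinearMap.range q.dualMap ≃ₗ[R] LinearMap.range K.subtype.dualMap :=
    (LinearEquiv.ofEq _ _ hmap).trans (Submodule.equivMapOfInjective _ hinj _).symm
  have hs : IsShortExact K.subtype p := IsShortExact.of_presentation hp hqp
  have := subsingleton_extGroup_of_projective (R := R) (A := F) (Y := R) 0
  refine ⟨(LinearMap.range K.subtype.dualMap).subtype ∘ₗ e.toLinearMap,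
    extConn hs R 0 ∘ₗ (extGroupZero R K R).symm.toLinearMap,
    ⟨(Submodule.subtype_injective _).comp e.injective, fun φ => ?_,
    (surjective_of_exact (exact_extConn_extMap hs R 0)).comp
      (extGroupZero R K R).symm.surjective⟩, ?_⟩
  · have hrange : φ ∈ Set.range ((LinearMap.range K.subtype.dualMap).subtype ∘ₗ e.toLinearMap) ↔
        φ ∈ LinearMap.range K.subtype.dualMap := by
      constructor
      · rintro ⟨x, rfl⟩
        exact (e x).2
      · intro h
        exact ⟨e.symm ⟨φ, h⟩, by simp⟩
    rw [hrange]
    refine (exact_extMap_extConn hs R 0 _).trans ⟨?_, ?_⟩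
    · rintro ⟨y, hy⟩
      refine ⟨extGroupZero R F R y, ?_⟩
      have := extGroupZero_extMap K.subtype y
      rw [hy] at this
      exact this.symm.trans ((extGroupZero R K R).apply_symm_apply φ)
    · rintro ⟨y, hy⟩
      refine ⟨(extGroupZero R F R).symm y, (extGroupZero R K R).injective ?_⟩
      rw [extGroupZero_extMap]
      simp only [LinearEquiv.apply_symm_apply, LinearEquiv.coe_coe]
      exact hy
  · ext1 x
    have h : (e.symm (e x) : Module.Dual R F') = q'.dualMap (e x) := rfl
    rw [LinearEquiv.symm_apply_apply] at h
    exact h.symm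

variable [IsLocalRing R]

theorem DepthGE.dual {n : ℕ} [Module.Free R F] [Module.Finite R F] (hR : DepthGE R n R) :
    DepthGE R n (Module.Dual R F) :=
  hR.free _

/-- If the modules `Ext^j(Z, R)` have depth at least `n - j` then the image of the dualized
first map of a presentation of `Z` has depth at least `n`. -/
theorem depthGE_range_dualMap [IsNoetherianRing R] {n : ℕ} (hR : DepthGE R n R)
    (F' F Z : Type) [AddCommGroup F'] [Module R F'] [AddCommGroup F] [Module R F]
    [AddCommGroup Z] [Module R Z] [Module.Free R F] [Module.Finite R F] [Module.Free R F']
    [Module.Finite R F'] (q : F' →ₗ[R] F) (p : F →ₗ[R] Z) (hp : Function.Surjective p)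
    (hqp : LinearMap.range q = LinearMap.ker p)
    (hZ : ∀ j, DepthGE R (n - (j + 1)) (ExtGroup R Z R (j + 1))) :
    DepthGE R n (LinearMap.range q.dualMap) := by
  induction n generalizing F' F Z with
  | zero => exact depthGE_zero
  | succ n ih =>
    obtain ⟨m, r₀, hr₀⟩ := Module.Finite.exists_fin' R (LinearMap.ker q.rangeRestrict)
    let r := (LinearMap.ker q.rangeRestrict).subtype ∘ₗ r₀
    have hr : LinearMap.range r = LinearMap.ker q.rangeRestrict := by
      rw [LinearMap.range_comp, LinearMap.range_eq_top.2 hr₀, Submodule.map_top,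
        Submodule.range_subtype]
    have hq := q.surjective_rangeRestrict
    have hK : DepthGE R (n + 1) (Module.Dual R (LinearMap.range q)) := by
      refine DepthGE.left (isShortExact_dualMap hq hr) hR.dual
        (ih (hR.mono (by lia)) _ _ _ r q.rangeRestrict hq hr fun j => ?_)
      exact ((hZ (j + 1)).congr (extShift hp hqp j).symm).mono (by lia)
    obtain ⟨j, δ, hs, -⟩ := exists_isShortExact_ext_one hp hqp
    exact hK.left hs (hZ 0)

theorem depthGE_range_dualMap_of_resolution [IsNoetherianRing R] {n : ℕ} (hR : DepthGE R n R)
    (i : ℕ) (M : Type) [AddCommGroup M] [Module R M] (F : ℕ → Type) [∀ i, AddCommGroup (F i)]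
    [∀ i, Module R (F i)] [∀ i, Module.Free R (F i)] [∀ i, Module.Finite R (F i)]
    (f : ∀ i : ℕ, F (i + 1) →ₗ[R] F i) (g : F 0 →ₗ[R] M) (hg : Function.Surjective g)
    (hfg : LinearMap.range (f 0) = LinearMap.ker g)
    (hex : ∀ j < i, LinearMap.range (f (j + 1)) = LinearMap.ker (f j))
    (hM : ∀ j, DepthGE R (n - (j + 1)) (ExtGroup R M R (i + (j + 1)))) :
    DepthGE R n (LinearMap.range (f i).dualMap) := by
  induction i generalizing M F with
  | zero =>
    refine depthGE_range_dualMap hR _ _ M (f 0) g hg hfg fun j => ?_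
    have := hM j
    rwa [zero_add] at this
  | succ i ih =>
    refine ih (LinearMap.range (f 0)) (fun j => F (j + 1)) (fun j => f (j + 1))
      (f 0).rangeRestrict (f 0).surjective_rangeRestrict ?_ (fun j hj => hex (j + 1) (by lia))
      fun j => ?_
    · rw [LinearMap.ker_rangeRestrict]
      exact hex 0 (by lia)
    · have := hM j
      rw [show i + 1 + (j + 1) = i + j + 1 + 1 by lia] at this
      exact this.congr (extShift hg hfg (i + j)).symm

theorem depthGE_ext_of_resolution {n : ℕ} (i : ℕ) (M : Type) [AddCommGroup M] [Module R M]
    (F : ℕ → Type) [∀ i, AddCommGroup (F i)] [∀ i, Module R (F i)] [∀ i, Module.Free R (F i)]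
    (f : ∀ i : ℕ, F (i + 1) →ₗ[R] F i) (g : F 0 →ₗ[R] M) (hg : Function.Surjective g)
    (hfg : LinearMap.range (f 0) = LinearMap.ker g)
    (hex : ∀ j < i, LinearMap.range (f (j + 1)) = LinearMap.ker (f j))
    (hI : DepthGE R (n + 1) (LinearMap.range (f i).dualMap))
    (hK : DepthGE R n (Module.Dual R (LinearMap.range (f i)))) :
    DepthGE R n (ExtGroup R M R (i + 1)) := by
  induction i generalizing M F with
  | zero =>
    obtain ⟨j, δ, hs, -⟩ := exists_isShortExact_ext_one hg hfg
    exact hI.right hs hK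
  | succ i ih =>
    have := ih (LinearMap.range (f 0)) (fun j => F (j + 1)) (fun j => f (j + 1))
      (f 0).rangeRestrict (f 0).surjective_rangeRestrict
      (by
        rw [LinearMap.ker_rangeRestrict]
        exact hex 0 (by lia)) (fun j hj => hex (j + 1) (by lia)) hI hK
    exact this.congr (extShift hg hfg i)

theorem slidingDepth_iff_of_resolution [IsNoetherianRing R] {d : ℕ} (hd : 2 ≤ d)
    (hR : DepthGE R d R) (M : Type) [AddCommGroup M] [Module R M] (F : ℕ → Type)
    [∀ i, AddCommGroup (F i)] [∀ i, Module R (F i)] [∀ i, Module.Free R (F i)]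
    [∀ i, Module.Finite R (F i)] (f : ∀ i : ℕ, F (i + 1) →ₗ[R] F i) (g : F 0 →ₗ[R] M)
    (hg : Function.Surjective g) (hfg : LinearMap.range (f 0) = LinearMap.ker g)
    (hex : ∀ i : ℕ, i + 3 ≤ d → LinearMap.range (f (i + 1)) = LinearMap.ker (f i)) :
    SlidingDepth R d M ↔ ∀ i ≤ d - 2, DepthGE R (d - i) (LinearMap.range (f i).dualMap) := by
  constructor
  · intro h i hi
    exact depthGE_range_dualMap_of_resolution (hR.mono (by lia)) i M F f g hg hfg
      (fun j hj => hex j (by lia)) fun j => (h (i + (j + 1))).mono (by lia)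
  · intro h i
    rcases i with _ | i
    · refine DepthGE.congr (extGroupZero R M R).symm ?_
      exact DepthGE.left' (isShortExact_dualMap hg hfg) hR.dual ((h 0 (by lia)).mono (by lia))
    rcases le_or_gt d (i + 1) with hi | hi
    · rw [Nat.sub_eq_zero_of_le hi]
      exact depthGE_zero
    refine depthGE_ext_of_resolution i M F f g hg hfg (fun j hj => hex j (by lia))
      ((h i (by lia)).mono (by lia)) ?_
    have hq := (f i).surjective_rangeRestrict
    rcases le_or_gt (d - (i + 1)) 1 with h1 | h1
    · exact DepthGE.of_injective (LinearMap.dualMap_injective_of_surjective hq) h1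
        (hR.mono (by lia)).dual
    · refine DepthGE.left' (isShortExact_dualMap (q := f (i + 1)) hq ?_)
        (hR.mono (by lia)).dual ((h (i + 1) (by lia)).mono (by lia))
      rw [LinearMap.ker_rangeRestrict]
      exact hex i (by lia)

end Syzygies

section Transpose

variable {R : Type} [CommRing R]

theorem exists_free_resolution [IsNoetherianRing R] (M : Type) [AddCommGroup M] [Module R M]
    [Module.Finite R M] : ∃ (n : ℕ → ℕ) (f : ∀ i, (Fin (n (i + 1)) → R) →ₗ[R] (Fin (n i) → R))
      (g : (Fin (n 0) → R) →ₗ[R] M), Function.Surjective g ∧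
      LinearMap.range (f 0) = LinearMap.ker g ∧
      ∀ i, LinearMap.range (f (i + 1)) = LinearMap.ker (f i) := by
  have key : ∀ (N : Type) [AddCommGroup N] [Module R N] (a : ℕ) (g : (Fin a → R) →ₗ[R] N),
      ∃ b, ∃ f : (Fin b → R) →ₗ[R] (Fin a → R), LinearMap.range f = LinearMap.ker g := by
    intro N _ _ a g
    obtain ⟨b, f, hf⟩ := Module.Finite.exists_fin' R (LinearMap.ker g)
    refine ⟨b, (LinearMap.ker g).subtype ∘ₗ f, ?_⟩
    rw [LinearMap.range_comp, LinearMap.range_eq_top.2 hf, Submodule.map_top,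
      Submodule.range_subtype]
  obtain ⟨a, g, hg⟩ := Module.Finite.exists_fin' R M
  obtain ⟨b, f, hf⟩ := key M a g
  choose m h hh using fun s : Σ a b : ℕ, ((Fin b → R) →ₗ[R] (Fin a → R)) =>
    key (Fin s.1 → R) s.2.1 s.2.2
  let s : ℕ → Σ a b : ℕ, ((Fin b → R) →ₗ[R] (Fin a → R)) := fun i =>
    Nat.rec ⟨a, b, f⟩ (fun _ s => ⟨s.2.1, m s, h s⟩) i
  exact ⟨fun i => (s i).1, fun i => (s i).2.2, g, hg, hf, fun i => hh (s i)⟩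

variable {I K E G J : Type} [AddCommGroup I] [Module R I] [AddCommGroup K] [Module R K]
  [AddCommGroup E] [Module R E] [AddCommGroup G] [Module R G] [AddCommGroup J] [Module R J]

/-- If two surjections out of `K` have the same kernel, their targets are isomorphic. -/
theorem nonempty_linearEquiv_of_ker_eq {δ : K →ₗ[R] E} {β : K →ₗ[R] G}
    (hδ : Function.Surjective δ) (h : LinearMap.ker δ = LinearMap.ker β) :
    Nonempty (E ≃ₗ[R] LinearMap.range β) :=
  ⟨(δ.quotKerEquivOfSurjective hδ).symm.trans
    ((Submodule.quotEquivOfEq _ _ h).trans β.quotKerEquivRange)⟩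

theorem exists_isShortExact_quotient {j : I →ₗ[R] K} {δ : K →ₗ[R] E} (h : IsShortExact j δ)
    {a : K →ₗ[R] G} {b : G →ₗ[R] J} (h' : IsShortExact a b) (S : Submodule R G)
    (hS : S = (LinearMap.range j).map a) :
    ∃ (α : E →ₗ[R] G ⧸ S) (β : (G ⧸ S) →ₗ[R] J), IsShortExact α β := by
  have hker : LinearMap.ker δ = LinearMap.ker (S.mkQ ∘ₗ a) := by
    rw [h.exact.linearMap_ker_eq, LinearMap.ker_comp, Submodule.ker_mkQ, hS,
      Submodule.comap_map_eq_of_injective h'.inj]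
  have hle : S ≤ LinearMap.ker b := by
    rw [hS, h'.exact.linearMap_ker_eq]
    exact LinearMap.map_le_range
  obtain ⟨e⟩ := nonempty_linearEquiv_of_ker_eq h.surj hker
  refine ⟨(LinearMap.range (S.mkQ ∘ₗ a)).subtype ∘ₗ e.toLinearMap, S.liftQ b hle,
    Subtype.val_injective.comp e.injective, ?_, ?_⟩
  · rw [LinearMap.exact_iff, LinearMap.range_comp, LinearEquiv.range, Submodule.map_top,
      Submodule.range_subtype, LinearMap.range_comp, Submodule.ker_liftQ,
      h'.exact.linearMap_ker_eq]
  · intro x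
    obtain ⟨y, rfl⟩ := h'.surj x
    exact ⟨S.mkQ y, S.liftQ_apply b y⟩

/-- The homology of the dual of a free resolution, placed in the cokernel. -/
theorem exists_isShortExact_ext_of_resolution (i : ℕ) (M : Type) [AddCommGroup M] [Module R M]
    (F : ℕ → Type) [∀ i, AddCommGroup (F i)] [∀ i, Module R (F i)] [∀ i, Module.Free R (F i)]
    (f : ∀ i : ℕ, F (i + 1) →ₗ[R] F i) (g : F 0 →ₗ[R] M) (hg : Function.Surjective g)
    (hfg : LinearMap.range (f 0) = LinearMap.ker g)
    (hex : ∀ j, LinearMap.range (f (j + 1)) = LinearMap.ker (f j)) :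
    ∃ (α : ExtGroup R M R (i + 1) →ₗ[R]
        Module.Dual R (F (i + 1)) ⧸ LinearMap.range (f i).dualMap)
      (β : (Module.Dual R (F (i + 1)) ⧸ LinearMap.range (f i).dualMap) →ₗ[R]
        LinearMap.range (f (i + 1)).dualMap),
      IsShortExact (C := LinearMap.range (f (i + 1)).dualMap) α β := by
  induction i generalizing M F with
  | zero =>
    have hq := (f 0).surjective_rangeRestrict
    have h1 := isShortExact_dualMap (q := f 1) hq (by
      rw [LinearMap.ker_rangeRestrict]
      exact hex 0)
    obtain ⟨j, δ, hs, hj⟩ := exists_isShortExact_ext_one hg hfg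
    refine exists_isShortExact_quotient hs h1 _ ?_
    rw [← LinearMap.range_comp]
    exact ((congrArg LinearMap.range hj).trans (Submodule.range_subtype _)).symm
  | succ i ih =>
    obtain ⟨α, β, h⟩ := ih (LinearMap.range (f 0)) (fun j => F (j + 1)) (fun j => f (j + 1))
      (f 0).rangeRestrict (f 0).surjective_rangeRestrict
      (by
        rw [LinearMap.ker_rangeRestrict]
        exact hex 0) (fun j => hex (j + 1))
    refine ⟨α ∘ₗ (extShift hg hfg i).symm.toLinearMap, β,
      h.inj.comp (extShift hg hfg i).symm.injective,
      ?_, h.surj⟩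
    rw [LinearMap.exact_iff, LinearMap.range_comp, LinearEquiv.range, Submodule.map_top,
      h.exact.linearMap_ker_eq]

variable {F' F Z : Type} [AddCommGroup F'] [Module R F'] [AddCommGroup F] [Module R F]
  [AddCommGroup Z] [Module R Z]

theorem dualEval_range_eq_ker {q : F' →ₗ[R] F} {p : F →ₗ[R] Z} (hp : Function.Surjective p)
    (hqp : LinearMap.range q = LinearMap.ker p) (x : F) :
    Module.Dual.eval R Z (p x) = 0 ↔
      Module.Dual.eval R F x ∈ LinearMap.range q.dualMap.rangeRestrict.dualMap := by
  have h := isShortExact_dualMap (Z := LinearMap.range q.dualMap)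
    (p := q.dualMap.rangeRestrict) (q := p.dualMap) q.dualMap.surjective_rangeRestrict (by
    rw [LinearMap.ker_rangeRestrict, LinearMap.ker_dualMap_eq_dualAnnihilator_range, hqp,
      ← LinearMap.range_dualMap_eq_dualAnnihilator_ker_of_surjective p hp])
  refine Iff.trans ?_ (h.exact (Module.Dual.eval R F x))
  rw [← Subtype.coe_inj]
  rfl

/-- `Ext¹` of the transpose of `Z` is the kernel of the biduality map of `Z`. -/
theorem nonempty_ext_one_transpose_equiv [Module.Free R F] [Module.Finite R F] [Module.Free R F']
    [Module.Finite R F'] {q : F' →ₗ[R] F} {p : F →ₗ[R] Z} (hp : Function.Surjective p)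
    (hqp : LinearMap.range q = LinearMap.ker p) :
    Nonempty (ExtGroup R (Module.Dual R F' ⧸ LinearMap.range q.dualMap) R 1 ≃ₗ[R]
      LinearMap.ker (Module.Dual.eval R Z)) := by
  obtain ⟨j, δ, hs, hj⟩ := exists_isShortExact_ext_one (q := q.dualMap)
    (LinearMap.range q.dualMap).mkQ_surjective (Submodule.ker_mkQ _).symm
  let e := Module.evalEquiv R F
  let β : Module.Dual R (LinearMap.range q.dualMap) →ₗ[R] Z :=
    p ∘ₗ e.symm.toLinearMap ∘ₗ q.dualMap.rangeRestrict.dualMap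
  have hinj : Function.Injective q.dualMap.rangeRestrict.dualMap :=
    LinearMap.dualMap_injective_of_surjective q.dualMap.surjective_rangeRestrict
  have hβ (φ) (x : F) (hx : e x = q.dualMap.rangeRestrict.dualMap φ) : β φ = p x := by
    change p (e.symm _) = _
    rw [← hx, e.symm_apply_apply]
  have hker : LinearMap.ker δ = LinearMap.ker β := by
    ext φ
    obtain ⟨x, hx⟩ := e.surjective (q.dualMap.rangeRestrict.dualMap φ)
    rw [LinearMap.mem_ker, LinearMap.mem_ker, hβ φ x hx, ← LinearMap.mem_ker (f := p), ← hqp,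
      hs.exact φ]
    constructor
    · rintro ⟨⟨_, y, rfl⟩, rfl⟩
      obtain ⟨z, rfl⟩ := (Module.evalEquiv R F').surjective y
      refine ⟨z, e.injective ?_⟩
      rw [hx]
      exact (LinearMap.congr_fun hj ⟨_, Module.evalEquiv R F' z, rfl⟩).symm
    · rintro ⟨z, rfl⟩
      refine ⟨⟨_, Module.evalEquiv R F' z, rfl⟩, hinj ?_⟩
      rw [← hx]
      exact LinearMap.congr_fun hj _
  have hrange : LinearMap.range β = LinearMap.ker (Module.Dual.eval R Z) := by
    ext z
    obtain ⟨x, rfl⟩ := hp z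
    rw [LinearMap.mem_ker, dualEval_range_eq_ker hp hqp]
    constructor
    · rintro ⟨φ, hφ⟩
      obtain ⟨y, hy⟩ := e.surjective (q.dualMap.rangeRestrict.dualMap φ)
      rw [hβ φ y hy] at hφ
      have h0 : Module.Dual.eval R Z (p y) = Module.Dual.eval R Z (p x) := by rw [hφ]
      have h1 : Module.Dual.eval R Z (p (x - y)) = 0 := by rw [map_sub, map_sub, h0, sub_self]
      rw [dualEval_range_eq_ker hp hqp, map_sub] at h1
      rw [← sub_add_cancel (Module.Dual.eval R F x) (Module.Dual.eval R F y)]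
      exact Submodule.add_mem _ h1 ⟨φ, hy.symm⟩
    · rintro ⟨φ, hφ⟩
      exact ⟨φ, hβ φ x hφ.symm⟩
  obtain ⟨e'⟩ := nonempty_linearEquiv_of_ker_eq hs.surj hker
  exact ⟨e'.trans (LinearEquiv.ofEq _ _ hrange)⟩

theorem dualEval_surjective [Module.Free R F] [Module.Finite R F]
    {q : F' →ₗ[R] F} {p : F →ₗ[R] Z} (hp : Function.Surjective p)
    (hqp : LinearMap.range q = LinearMap.ker p)
    (h : Subsingleton (ExtGroup R (LinearMap.range q.dualMap) R 1)) :
    Function.Surjective (Module.Dual.eval R Z) := by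
  intro ψ
  have hs := isShortExact_dualMap hp hqp
  obtain ⟨y, hy⟩ := surjective_of_exact (exact_extMap_extConn hs R 0)
    ((extGroupZero R (Module.Dual R Z) R).symm ψ)
  obtain ⟨x, hx⟩ := (Module.evalEquiv R F).surjective (extGroupZero R (Module.Dual R F) R y)
  refine ⟨p x, LinearMap.ext fun φ => ?_⟩
  have h1 := extGroupZero_extMap p.dualMap y
  rw [hy, LinearEquiv.apply_symm_apply, ← hx] at h1
  rw [h1]
  rfl

end Transpose

section Backward

variable {R : Type} [CommRing R]

theorem nonempty_ext_transpose_equiv (i : ℕ) (M : Type) [AddCommGroup M] [Module R M]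
    (F : ℕ → Type) [∀ i, AddCommGroup (F i)] [∀ i, Module R (F i)] [∀ i, Module.Free R (F i)]
    [∀ i, Module.Finite R (F i)]
    (f : ∀ i : ℕ, F (i + 1) →ₗ[R] F i) (g : F 0 →ₗ[R] M) (hg : Function.Surjective g)
    (hfg : LinearMap.range (f 0) = LinearMap.ker g)
    (hex : ∀ j, LinearMap.range (f (j + 1)) = LinearMap.ker (f j))
    (hM : ∀ j ≤ i, Subsingleton (ExtGroup R M R j)) :
    Nonempty (ExtGroup R (Module.Dual R (F (i + 1)) ⧸ LinearMap.range (f i).dualMap) R (i + 1)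
      ≃ₗ[R] M) := by
  induction i with
  | zero =>
    obtain ⟨e⟩ := nonempty_ext_one_transpose_equiv hg hfg
    have : Subsingleton (Module.Dual R M) :=
      have := hM 0 le_rfl
      (extGroupZero R M R).symm.injective.subsingleton
    refine ⟨e.trans (LinearEquiv.ofTop _ ?_)⟩
    refine LinearMap.ker_eq_top.2 (LinearMap.ext fun x => LinearMap.ext fun φ => ?_)
    rw [Subsingleton.elim φ 0, map_zero, map_zero]
  | succ i ih =>
    obtain ⟨e⟩ := ih fun j hj => hM j (by lia)
    obtain ⟨α, β, h⟩ := exists_isShortExact_ext_of_resolution i M F f g hg hfg hex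
    have := hM (i + 1) le_rfl
    have hβ : Function.Bijective β := by
      refine ⟨(injective_iff_map_eq_zero β).2 fun x hx => ?_, h.surj⟩
      obtain ⟨y, rfl⟩ := (h.exact x).1 hx
      rw [Subsingleton.elim y 0, map_zero]
    exact ⟨(extShift (LinearMap.range (f (i + 1)).dualMap).mkQ_surjective
      (Submodule.ker_mkQ _).symm i).symm.trans
        ((extGroupCongr (LinearEquiv.ofBijective β hβ) R (i + 1)).trans e)⟩

variable [IsLocalRing R] [IsNoetherianRing R]

/-- A module of dimension at most `d - c` with sliding depth surjects onto a module which is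
zero or Cohen-Macaulay of dimension `d - c`, with kernel of smaller dimension. -/
theorem exists_surjective_of_slidingDepth {d c : ℕ} (hc : c ≤ d)
    (hG : ∀ i, i ≠ d → Subsingleton (ExtGroup R (ResidueField R) R i)) (M : Type)
    [AddCommGroup M] [Module R M] [Module.Finite R M] (hdim : DimLT R (d + 1 - c) M)
    (hM : SlidingDepth R d M) :
    ∃ (N : ModuleCat.{0} R) (φ : M →ₗ[R] N), Module.Finite R N ∧ Function.Surjective φ ∧
      DimLT R (d - c) (LinearMap.ker φ) ∧ DepthGE R (d - c) N ∧ DimLT R (d - c + 1) N := by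
  have hR : DepthGE R d R := fun i hi => hG i hi.ne
  obtain ⟨n, f, g, hg, hfg, hex⟩ := exists_free_resolution (R := R) M
  have hI : DepthGE R (d - c) (LinearMap.range (f c).dualMap) :=
    depthGE_range_dualMap_of_resolution (hR.mono (by lia)) c M (fun i => Fin (n i) → R) f g hg hfg
      (fun j _ => hex j) fun j => (hM (c + (j + 1))).mono (by lia)
  have hI1 : Subsingleton (ExtGroup R (LinearMap.range (f c).dualMap) R (c + 1)) :=
    subsingleton_ext_of_depthGE hG _ hI (by lia)
  have hN : DepthGE R (d - c) (ExtGroup R (ExtGroup R M R c) R c) :=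
    depthGE_ext_of_isCM hG _ (hM c) ((dimLT_ext hG M c).mono (by lia)) (by lia)
  have hNd : DimLT R (d - c + 1) (ExtGroup R (ExtGroup R M R c) R c) :=
    (dimLT_ext hG _ c).mono (by lia)
  cases c with
  | zero =>
    let e : ExtGroup R (ExtGroup R M R 0) R 0 ≃ₗ[R] Module.Dual R (Module.Dual R M) :=
      (extGroupCongr (extGroupZero R M R).symm R 0).trans (extGroupZero R (Module.Dual R M) R)
    refine ⟨ModuleCat.of R (Module.Dual R (Module.Dual R M)), Module.Dual.eval R M,
      inferInstanceAs (Module.Finite R (Module.Dual R (Module.Dual R M))),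
      dualEval_surjective hg hfg hI1, ?_, hN.congr e, hNd.congr e⟩
    obtain ⟨e'⟩ := nonempty_ext_one_transpose_equiv hg hfg
    exact ((dimLT_ext hG _ 1).mono (by lia)).congr e'
  | succ c =>
    obtain ⟨e⟩ := nonempty_ext_transpose_equiv c M (fun i => Fin (n i) → R) f g hg hfg hex
      fun j hj => subsingleton_ext_of_dimLT hG M (hdim.mono (by lia))
    obtain ⟨α, β, h⟩ :=
      exists_isShortExact_ext_of_resolution c M (fun i => Fin (n i) → R) f g hg hfg hex
    refine ⟨ModuleCat.of R (ExtGroup R (ExtGroup R M R (c + 1)) R (c + 1)),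
      extMap α R (c + 1) ∘ₗ e.symm.toLinearMap, ?_,
      (surjective_of_exact (exact_extMap_extConn h R (c + 1))).comp e.symm.surjective, ?_, hN, hNd⟩
    · change Module.Finite R (ExtGroup R (ExtGroup R M R (c + 1)) R (c + 1))
      infer_instance
    · have h1 : DimLT R (d - (c + 1)) (LinearMap.ker (extMap α R (c + 1))) := by
        rw [(exact_extMap_extMap h R (c + 1)).linearMap_ker_eq]
        refine DimLT.of_surjective (LinearMap.surjective_rangeRestrict _) ?_
        exact ((dimLT_ext hG _ (c + 2)).mono (by lia)).congr
          (extShift (LinearMap.range (f (c + 1)).dualMap).mkQ_surjective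
            (Submodule.ker_mkQ _).symm c).symm
      refine h1.of_injective (f := (e.symm.toLinearMap.restrict fun x hx => hx)) ?_
      intro x y hxy
      exact Subtype.ext (e.symm.injective (congrArg Subtype.val hxy))

theorem SlidingDepth.ker {d k : ℕ} (hk : k ≤ d)
    (hG : ∀ i, i ≠ d → Subsingleton (ExtGroup R (ResidueField R) R i)) {M N : Type}
    [AddCommGroup M] [Module R M] [Module.Finite R M] [AddCommGroup N] [Module R N]
    [Module.Finite R N] {φ : M →ₗ[R] N} (hφ : Function.Surjective φ) (hM : SlidingDepth R d M)
    (hK : DimLT R k (LinearMap.ker φ)) (hN : DepthGE R k N) (hNd : DimLT R (k + 1) N) :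
    SlidingDepth R d (LinearMap.ker φ) := by
  intro i
  rcases le_or_gt i (d - k) with hi | hi
  · have := subsingleton_ext_of_dimLT hG (LinearMap.ker φ) (i := i) (hK.mono (by lia))
    exact depthGE_of_subsingleton _
  · exact (hM i).congr (LinearEquiv.ofBijective _
      (extMap_bijective_of_right (IsShortExact.of_surjective φ hφ)
        (subsingleton_ext_of_isCM hG N hN hNd (by lia))
        (subsingleton_ext_of_isCM hG N hN hNd (by lia))))

theorem exists_filtration_of_slidingDepth {d : ℕ}
    (hG : ∀ i, i ≠ d → Subsingleton (ExtGroup R (ResidueField R) R i)) (M : Type)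
    [AddCommGroup M] [Module R M] [Module.Finite R M] (k : ℕ) (hk : k ≤ d + 1)
    (L : Submodule R M) (hL : DimLT R k L) (hS : SlidingDepth R d L) :
    ∃ (r : ℕ) (Φ : Fin (r + 1) → Submodule R M), Φ 0 = ⊥ ∧ Φ (Fin.last r) = L ∧ StrictMono Φ ∧
      (∀ i : Fin r, isCM R (↥(Φ i.succ) ⧸ (Φ i.castSucc).comap (Φ i.succ).subtype)) ∧
      (∀ i : Fin r, mdim R (↥(Φ i.succ) ⧸ (Φ i.castSucc).comap (Φ i.succ).subtype) < (k : ℕ)) ∧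
      (∀ i j : Fin r, i < j →
        mdim R (↥(Φ i.succ) ⧸ (Φ i.castSucc).comap (Φ i.succ).subtype) <
        mdim R (↥(Φ j.succ) ⧸ (Φ j.castSucc).comap (Φ j.succ).subtype)) := by
  induction k generalizing L with
  | zero =>
    rw [dimLT_zero_iff, Submodule.subsingleton_iff_eq_bot] at hL
    exact ⟨0, fun _ => ⊥, rfl, hL.symm, fun i j h => absurd h (by lia), fun i => i.elim0,
      fun i => i.elim0, fun i => i.elim0⟩
  | succ k ih =>
    obtain ⟨N, φ, _, hφ, hker, hN, hNd⟩ := exists_surjective_of_slidingDepth (c := d - k)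
      (by lia) hG L (hL.mono (by lia)) hS
    rw [show d - (d - k) = k by lia] at hker hN hNd
    have hSk := hS.ker (by lia) hG hφ hker hN hNd
    let e := Submodule.equivMapOfInjective L.subtype L.injective_subtype (LinearMap.ker φ)
    obtain ⟨r, Φ, h0, hlast, hmono, hCM, hlt, hdim⟩ := ih (by lia) _ (hker.congr e) (hSk.congr e)
    rcases subsingleton_or_nontrivial N with hN0 | hN0
    · refine ⟨r, Φ, h0, ?_, hmono, hCM, fun i => (hlt i).trans (by norm_cast; lia), hdim⟩
      rw [hlast, LinearMap.ker_eq_top.2 (LinearMap.ext fun x => Subsingleton.elim _ _),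
        Submodule.map_top, Submodule.range_subtype]
    obtain ⟨hCMN, hdimN⟩ := isCM_of_depthGE_of_dimLT hN hNd
    have hquot : ((LinearMap.ker φ).map L.subtype).comap L.subtype = LinearMap.ker φ :=
      Submodule.comap_map_eq_of_injective L.injective_subtype _
    have e' : (L ⧸ ((LinearMap.ker φ).map L.subtype).comap L.subtype) ≃ₗ[R] N :=
      (Submodule.quotEquivOfEq _ _ hquot).trans (φ.quotKerEquivOfSurjective hφ)
    have hcm : isCM R (L ⧸ ((LinearMap.ker φ).map L.subtype).comap L.subtype) ∧
        mdim R (L ⧸ ((LinearMap.ker φ).map L.subtype).comap L.subtype) = (k : ℕ) :=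
      have := e'.toEquiv.nontrivial
      isCM_of_depthGE_of_dimLT (hN.congr e'.symm) (hNd.congr e'.symm)
    have hlt' : (LinearMap.ker φ).map L.subtype < L := by
      refine lt_of_le_of_ne (Submodule.map_subtype_le _ _) fun hc => ?_
      obtain ⟨y, hy⟩ := exists_ne (0 : N)
      obtain ⟨x, rfl⟩ := hφ y
      have : x ∈ LinearMap.ker φ := by
        rw [← hquot, hc, Submodule.mem_comap]
        exact x.2
      exact hy this
    let P (A B : Submodule R M) : Prop := isCM R (↥B ⧸ A.comap B.subtype)
    let D (A B : Submodule R M) : WithBot ℕ∞ := mdim R (↥B ⧸ A.comap B.subtype)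
    let Ψ : Fin (r + 1 + 1) → Submodule R M := Fin.snoc Φ L
    have hΨ (i : Fin (r + 1)) : Ψ i.castSucc = Φ i := Fin.snoc_castSucc ..
    have hΨl : Ψ (Fin.last (r + 1)) = L := Fin.snoc_last ..
    have hΨs (i : Fin r) : Ψ i.castSucc.succ = Φ i.succ := by rw [← Fin.castSucc_succ, hΨ]
    have hΨsl : Ψ (Fin.last r).succ = L := hΨl
    refine ⟨r + 1, Ψ, (hΨ 0).trans h0, hΨl, ?_, ?_, ?_, ?_⟩
    · rw [Fin.strictMono_iff_lt_succ]
      intro i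
      induction i using Fin.lastCases with
      | last => rwa [hΨ, hΨsl, hlast]
      | cast i =>
        rw [hΨ, hΨs]
        exact hmono i.castSucc_lt_succ
    · intro i
      change P (Ψ i.castSucc) (Ψ i.succ)
      induction i using Fin.lastCases with
      | last =>
        rw [hΨ, hΨsl, hlast]
        exact hcm.1
      | cast i =>
        rw [hΨ, hΨs]
        exact hCM i
    · intro i
      change D (Ψ i.castSucc) (Ψ i.succ) < _
      induction i using Fin.lastCases with
      | last =>
        rw [hΨ, hΨsl, hlast]
        exact hcm.2.trans_lt (by norm_cast; lia)
      | cast i =>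
        rw [hΨ, hΨs]
        exact (hlt i).trans (by norm_cast; lia)
    · intro i j hij
      change D (Ψ i.castSucc) (Ψ i.succ) < D (Ψ j.castSucc) (Ψ j.succ)
      induction i using Fin.lastCases with
      | last => exact absurd hij (not_lt.2 (Fin.le_last j))
      | cast i =>
        rw [hΨ, hΨs]
        induction j using Fin.lastCases with
        | last =>
          rw [hΨ, hΨsl, hlast]
          exact (hlt i).trans_eq hcm.2.symm
        | cast j =>
          rw [hΨ, hΨs]
          exact hdim i j hij

theorem isSeqCM_of_slidingDepth {d : ℕ} (hdim : ringKrullDim R = (d : ℕ))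
    (hG : ∀ i, i ≠ d → Subsingleton (ExtGroup R (ResidueField R) R i)) (M : Type)
    [AddCommGroup M] [Module R M] [Module.Finite R M] (hS : SlidingDepth R d M) :
    isSeqCM R M := by
  have hd : DimLT R (d + 1) M := by
    refine (Module.supportDim_le_ringKrullDim R M).trans_lt ?_
    rw [hdim]
    norm_cast
    lia
  obtain ⟨r, Φ, h0, hlast, hmono, hCM, -, hlt⟩ := exists_filtration_of_slidingDepth hG M (d + 1)
    le_rfl ⊤ (hd.congr Submodule.topEquiv.symm) (hS.congr Submodule.topEquiv.symm)
  exact ⟨r, Φ, h0, hlast, hmono, hCM, hlt⟩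

end Backward

/-- Over a Gorenstein Noetherian local ring of dimension `d ≥ 2` (Gorenstein:
`R` is its own canonical module), given a finite free resolution
`F_{d-1} → ⋯ → F₁ → F₀ → M → 0`, the module `M` is sequentially Cohen-Macaulay iff
`depth λΩ^i M ≥ d - i` for all `0 ≤ i ≤ d-2`, where `λΩ^i M = image((f i)*)`. -/
theorem statement4 (R : Type) [CommRing R] [IsNoetherianRing R] [IsLocalRing R]
    (d : ℕ) (hd : 2 ≤ d) (hdim : ringKrullDim R = (d : ℕ))
    (hGor : isCanonicalModule R d R)
    (M : Type) [AddCommGroup M] [Module R M] [Module.Finite R M]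
    (F : ℕ → Type) [∀ i, AddCommGroup (F i)] [∀ i, Module R (F i)]
    [∀ i, Module.Free R (F i)] [∀ i, Module.Finite R (F i)]
    (f : ∀ i : ℕ, F (i + 1) →ₗ[R] F i) (g : F 0 →ₗ[R] M)
    (hg : Function.Surjective g) (hfg : LinearMap.range (f 0) = LinearMap.ker g)
    (hex : ∀ i : ℕ, i + 3 ≤ d → LinearMap.range (f (i + 1)) = LinearMap.ker (f i)) :
    isSeqCM R M ↔ ∀ i : ℕ, i ≤ d - 2 →
        ((d - i : ℕ) : ℕ∞) ≤ rdepth R ↥(LinearMap.range (f i).dualMap) := by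
  have hG : ∀ i, i ≠ d → Subsingleton (ExtGroup R (ResidueField R) R i) := fun i hi =>
    (extMod_subsingleton_iff (ResidueField R) R i).1 (hGor.2.1 i hi)
  have hR : DepthGE R d R := fun i hi => hG i hi.ne
  have h : isSeqCM R M ↔ SlidingDepth R d M :=
    ⟨slidingDepth_of_isSeqCM hdim hG M, isSeqCM_of_slidingDepth hdim hG M⟩
  rw [h, slidingDepth_iff_of_resolution hd hR M F f g hg hfg hex]
  exact forall₂_congr fun i _ => (le_rdepth_iff _ _).symm
end

section
/- Let (R, 𝔪) be a Cohen-Macaulay Noetherian local ring of Krull dimension d ≥ 1 with a canonical module ω_R. Let M be a finitely generated R-module such that Ass_R(M) ⊆ Ass_R(R) ∪ {𝔪} and M satisfies Serre's condition (S₂) on the punctured spectrum. Let φ : M → M^{∨∨} = Hom_R(Hom_R(M, ω_R), ω_R) be the natural evaluation map. Then ker(φ) = Γ_𝔪(M), the 𝔪-torsion submodule of M (equivalently, ker(φ) ≅ H^0_𝔪(M)). -/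
open CategoryTheory Opposite IsLocalRing

section ExtHelpers

variable {R : Type} [CommRing R]

/-- The module `Ext^i_R(N, W)`, computed in the derived category of `R`-modules. -/
noncomputable abbrev derivedExt (R : Type) [CommRing R] (N W : Type) [AddCommGroup N] [Module R N]
    [AddCommGroup W] [Module R W] (i : ℕ) : Type :=
  Abelian.Ext (ModuleCat.of R N) (ModuleCat.of R W) i

variable (W : Type) [AddCommGroup W] [Module R W]
  {N₁ N₂ N₃ : Type} [AddCommGroup N₁] [Module R N₁] [AddCommGroup N₂] [Module R N₂]
  [AddCommGroup N₃] [Module R N₃]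

theorem subsingleton_extMod_iff (N : Type) [AddCommGroup N] [Module R N] (i : ℕ) :
    Subsingleton (extMod R N W i) ↔ Subsingleton (derivedExt R N W i) := by
  let P := projectiveResolution (ModuleCat.of R N)
  have e := P.isoExt (R := R) i (ModuleCat.of R W)
  rw [extMod, ← ModuleCat.isZero_iff_subsingleton, e.isZero_iff,
    ← HomologicalComplex.exactAt_iff_isZero_homology]
  cases i with
  | zero =>
    rw [HomologicalComplex.exactAt_iff' _ 0 0 1 (by simp) (by simp),
      ShortComplex.moduleCat_exact_iff]
    constructor
    · intro h
      refine subsingleton_of_forall_eq 0 fun e => ?_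
      obtain ⟨f, hf, rfl⟩ := P.extMk_surjective e 1 rfl
      obtain ⟨g, hg⟩ := h f hf
      have hd : (HomologicalComplex.sc' (P.complex.linearYonedaObj R (ModuleCat.of R W)) 0 0 1).f
          = 0 := (P.complex.linearYonedaObj R (ModuleCat.of R W)).shape 0 0 (by simp)
      rw [hd] at hg
      have h0 : f = 0 := hg.symm
      subst h0
      simp
    · intro h f hf
      have hg := P.exact₀.g_desc f hf
      have hzero : ∀ u : ModuleCat.of R N ⟶ ModuleCat.of R W, u = 0 := fun u =>
        Abelian.Ext.addEquiv₀.symm.injective (Subsingleton.elim _ _)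
      have h0 : P.exact₀.desc f hf = 0 := hzero _
      rw [h0, Limits.comp_zero] at hg
      exact ⟨0, (map_zero _).trans hg⟩
  | succ i =>
    rw [HomologicalComplex.exactAt_iff' _ i (i + 1) (i + 1 + 1) (by simp) (by simp),
      ShortComplex.moduleCat_exact_iff]
    constructor
    · intro h
      refine subsingleton_of_forall_eq 0 fun e => ?_
      obtain ⟨f, hf, rfl⟩ := P.extMk_surjective e (i + 1 + 1) rfl
      rw [P.extMk_eq_zero_iff f _ rfl hf i rfl]
      exact h f hf
    · intro h f hf
      exact (P.extMk_eq_zero_iff f _ rfl hf i rfl).1 (Subsingleton.elim _ _)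

/-- Precomposition with a linear map on `Ext`. -/
noncomputable def extPrecomp (f : N₁ →ₗ[R] N₂) (i : ℕ) :
    derivedExt R N₂ W i →ₗ[R] derivedExt R N₁ W i :=
  (Abelian.Ext.mk₀ (ModuleCat.ofHom f)).precompOfLinear R (ModuleCat.of R W) (zero_add i)

theorem extPrecomp_comp (f : N₁ →ₗ[R] N₂) (g : N₂ →ₗ[R] N₃) (i : ℕ)
    (e : derivedExt R N₃ W i) :
    extPrecomp W (g ∘ₗ f) i e = extPrecomp W f i (extPrecomp W g i e) := by
  simp [extPrecomp, ModuleCat.ofHom_comp, Abelian.Ext.precompOfLinear]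

theorem extPrecomp_smul_id (a : R) (i : ℕ) (e : derivedExt R N₁ W i) :
    extPrecomp W (a • (LinearMap.id : N₁ →ₗ[R] N₁)) i e = a • e := by
  have h : ModuleCat.ofHom (a • (LinearMap.id : N₁ →ₗ[R] N₁)) = a • 𝟙 _ := rfl
  simp [extPrecomp, Abelian.Ext.precompOfLinear, h, Abelian.Ext.mk₀_smul]

theorem ext_smul_eq_zero_of_left {a : R} (h : ∀ x : N₁, a • x = 0) (i : ℕ)
    (e : derivedExt R N₁ W i) : a • e = 0 := by
  have h' : a • (LinearMap.id : N₁ →ₗ[R] N₁) = 0 := LinearMap.ext h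
  rw [← extPrecomp_smul_id, h']
  simp [extPrecomp, Abelian.Ext.precompOfLinear]

theorem ext_smul_eq_zero_of_right {a : R} (h : ∀ x : W, a • x = 0) (i : ℕ)
    (e : derivedExt R N₁ W i) : a • e = 0 := by
  have h' : a • 𝟙 (ModuleCat.of R W) = 0 := ModuleCat.hom_ext (LinearMap.ext h)
  rw [Abelian.Ext.smul_eq_comp_mk₀, h']
  simp

theorem shortExact_ofHom {f : N₁ →ₗ[R] N₂} {g : N₂ →ₗ[R] N₃} (hf : Function.Injective f)
    (hg : Function.Surjective g) (hfg : Function.Exact f g) :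
    (ShortComplex.mk (ModuleCat.ofHom f) (ModuleCat.ofHom g)
      (ModuleCat.hom_ext hfg.linearMap_comp_eq_zero)).ShortExact where
  exact := (ShortComplex.ShortExact.moduleCat_exact_iff_function_exact _).2 hfg
  mono_f := (ModuleCat.mono_iff_injective _).2 hf
  epi_g := (ModuleCat.epi_iff_surjective _).2 hg

theorem extPrecomp_exact {f : N₁ →ₗ[R] N₂} {g : N₂ →ₗ[R] N₃} (hf : Function.Injective f)
    (hg : Function.Surjective g) (hfg : Function.Exact f g) (i : ℕ) :
    Function.Exact (extPrecomp W g i) (extPrecomp W f i) := by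
  intro e
  constructor
  · exact fun he => Abelian.Ext.contravariant_sequence_exact₂ (shortExact_ofHom hf hg hfg) _ e he
  · rintro ⟨e, rfl⟩
    rw [← extPrecomp_comp, hfg.linearMap_comp_eq_zero]
    simp [extPrecomp, Abelian.Ext.precompOfLinear]

theorem exists_ext_connecting {f : N₁ →ₗ[R] N₂} {g : N₂ →ₗ[R] N₃} (hf : Function.Injective f)
    (hg : Function.Surjective g) (hfg : Function.Exact f g) (i : ℕ) :
    ∃ δ : derivedExt R N₁ W i →ₗ[R] derivedExt R N₃ W (i + 1),
      (∀ e, δ e = 0 → ∃ e', extPrecomp W f i e' = e) ∧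
      (∀ e, extPrecomp W g (i + 1) e = 0 → ∃ e', δ e' = e) :=
  ⟨(shortExact_ofHom hf hg hfg).extClass.precompOfLinear R (ModuleCat.of R W) (add_comm 1 i),
    fun e he => Abelian.Ext.contravariant_sequence_exact₁ (shortExact_ofHom hf hg hfg) _ e
      (add_comm 1 i) he,
    fun e he => Abelian.Ext.contravariant_sequence_exact₃ (shortExact_ofHom hf hg hfg) _ e he
      (add_comm 1 i)⟩

theorem support_derivedExt_subset {f : N₁ →ₗ[R] N₂} {g : N₂ →ₗ[R] N₃}
    (hf : Function.Injective f) (hg : Function.Surjective g) (hfg : Function.Exact f g) (i : ℕ) :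
    Module.support R (derivedExt R N₂ W i) ⊆
      Module.support R (derivedExt R N₁ W i) ∪ Module.support R (derivedExt R N₃ W i) := by
  intro q hq
  by_contra h
  rw [Set.mem_union, not_or, Module.notMem_support_iff', Module.notMem_support_iff'] at h
  refine Module.notMem_support_iff'.2 (fun e => ?_) hq
  obtain ⟨s, hs, hse⟩ := h.1 (extPrecomp W f i e)
  rw [← map_smul] at hse
  obtain ⟨e', he'⟩ := (extPrecomp_exact W hf hg hfg i _).1 hse
  obtain ⟨t, ht, hte⟩ := h.2 e'
  refine ⟨t * s, q.2.mul_notMem ht hs, ?_⟩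
  rw [mul_smul, ← he', ← map_smul, hte, map_zero]

theorem notMem_support_derivedExt_of_quotient [IsNoetherianRing R] (J : Ideal R)
    (q : PrimeSpectrum R) (i : ℕ)
    (h : ∀ r : PrimeSpectrum R, J ≤ r.1 → q ∉ Module.support R (derivedExt R (R ⧸ r.1) W i))
    (N : Type) [AddCommGroup N] [Module R N] [Module.Finite R N]
    (hN : ∀ a ∈ J, ∀ x : N, a • x = 0) :
    q ∉ Module.support R (derivedExt R N W i) := by
  revert hN
  induction ‹Module.Finite R N› using
    IsNoetherianRing.induction_on_isQuotientEquivQuotientPrime R with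
  | subsingleton N =>
    intro _
    refine Module.notMem_support_iff'.2 fun e => ⟨1, q.1.primeCompl.one_mem, ?_⟩
    exact ext_smul_eq_zero_of_left W (fun x => Subsingleton.elim _ _) i e
  | quotient N p e =>
    intro hN hq
    have hJ : J ≤ p.1 := by
      intro a ha
      have h1 := congrArg e (hN a ha (e.symm (Ideal.Quotient.mk p.1 1)))
      rw [map_smul, LinearEquiv.apply_symm_apply, map_zero, Algebra.smul_def] at h1
      simpa [Ideal.Quotient.eq_zero_iff_mem] using h1
    refine h p hJ (Module.support_subset_of_injective (extPrecomp W e.symm.toLinearMap i) ?_ hq)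
    refine Function.LeftInverse.injective (g := extPrecomp W e.toLinearMap i) fun x => ?_
    rw [← extPrecomp_comp]
    have := extPrecomp_smul_id W 1 i x
    simpa using this
  | exact N₁ N₂ N₃ f g hf hg hfg h₁ h₃ =>
    intro hN hq
    rcases support_derivedExt_subset W hf hg hfg i hq with hq | hq
    · refine h₁ (fun a ha x => hf ?_) hq
      rw [map_smul, map_zero, hN a ha]
    · refine h₃ (fun a ha x => ?_) hq
      obtain ⟨y, rfl⟩ := hg x
      rw [← map_smul, hN a ha, map_zero]

theorem notMem_support_derivedExt_quotient_of_not_le {q r : PrimeSpectrum R} (h : ¬ r ≤ q)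
    (i : ℕ) : q ∉ Module.support R (derivedExt R (R ⧸ r.1) W i) := by
  obtain ⟨s, hs, hsq⟩ := SetLike.not_le_iff_exists.1 (show ¬ r.1 ≤ q.1 from h)
  refine Module.notMem_support_iff'.2 fun e => ⟨s, hsq, ext_smul_eq_zero_of_left W (fun x => ?_) i e⟩
  obtain ⟨x, rfl⟩ := Ideal.Quotient.mk_surjective x
  rw [Algebra.smul_def, Ideal.Quotient.algebraMap_eq, Ideal.Quotient.eq_zero_iff_mem.2 hs, zero_mul]

theorem notMem_support_derivedExt_of_covBy [IsNoetherianRing R] [Module.Finite R W]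
    {p q : PrimeSpectrum R} (hpq : p ⋖ q) (i : ℕ)
    (h : q ∉ Module.support R (derivedExt R (R ⧸ q.1) W (i + 1))) :
    p ∉ Module.support R (derivedExt R (R ⧸ p.1) W i) := by
  obtain ⟨x, hxq, hxp⟩ := SetLike.exists_of_lt (show p.1 < q.1 from hpq.lt)
  suffices H : q ∉ Module.support R (derivedExt R (R ⧸ p.1) W i) from
    fun hp => H (Module.mem_support_mono hpq.le hp)
  set f : (R ⧸ p.1) →ₗ[R] (R ⧸ p.1) := x • LinearMap.id with hf_def
  have hx0 : (Ideal.Quotient.mk p.1 x) ≠ 0 := by rwa [Ne, Ideal.Quotient.eq_zero_iff_mem]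
  have hf : Function.Injective f := by
    refine (injective_iff_map_eq_zero f).2 fun y hy => ?_
    have hy' : Ideal.Quotient.mk p.1 x * y = 0 := by
      simpa [hf_def, Algebra.smul_def] using hy
    exact (mul_eq_zero.1 hy').resolve_left hx0
  obtain ⟨δ, hδ, -⟩ := exists_ext_connecting W hf (Submodule.mkQ_surjective (LinearMap.range f))
    (LinearMap.exact_map_mkQ_range f) i
  have hker : q ∉ Module.support R (derivedExt R ((R ⧸ p.1) ⧸ LinearMap.range f) W (i + 1)) := by
    refine notMem_support_derivedExt_of_quotient W (p.1 ⊔ Ideal.span {x}) q (i + 1) ?_ _ ?_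
    · intro r hr
      by_cases hrq : r ≤ q
      · have hpr : p < r := lt_of_le_of_ne (le_sup_left.trans hr) <| by
          rintro rfl
          exact hxp (hr (Ideal.mem_sup_right (Ideal.mem_span_singleton_self x)))
        obtain rfl : r = q := (hpq.eq_or_eq hpr.le hrq).resolve_left hpr.ne'
        exact h
      · exact notMem_support_derivedExt_quotient_of_not_le W hrq _
    · intro a ha y
      obtain ⟨y, rfl⟩ := Submodule.mkQ_surjective _ y
      rw [← map_smul]
      obtain ⟨b, hb, c, hc, rfl⟩ := Submodule.mem_sup.1 ha
      obtain ⟨c, rfl⟩ := Ideal.mem_span_singleton'.1 hc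
      refine (Submodule.Quotient.mk_eq_zero _).2 ⟨c • y, ?_⟩
      have hb0 : b • y = 0 := by
        rw [Algebra.smul_def, Ideal.Quotient.algebraMap_eq, Ideal.Quotient.eq_zero_iff_mem.2 hb,
          zero_mul]
      rw [add_smul, hb0, zero_add, mul_comm, mul_smul]
      rfl
  intro hq
  have hq' : q ∈ Module.support R (QuotSMulTop x (derivedExt R (R ⧸ p.1) W i)) := by
    rw [Module.support_quotSMulTop]
    exact ⟨hq, by simpa using hxq⟩
  refine Module.notMem_support_iff'.2 (fun e => ?_) hq'
  obtain ⟨e, rfl⟩ := Submodule.mkQ_surjective _ e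
  obtain ⟨s, hs, hse⟩ := Module.notMem_support_iff'.1 hker (δ e)
  rw [← map_smul] at hse
  obtain ⟨e', he'⟩ := hδ _ hse
  refine ⟨s, hs, ?_⟩
  rw [← map_smul, ← he', extPrecomp_smul_id]
  exact (Submodule.Quotient.mk_eq_zero _).2 (Submodule.smul_mem_pointwise_smul _ _ _ trivial)

end ExtHelpers

section CanonicalModule

variable {R : Type} [CommRing R] [IsLocalRing R] {d : ℕ}
  {W : Type} [AddCommGroup W] [Module R W]

theorem isCanonicalModule.subsingleton_derivedExt (hW : isCanonicalModule R d W) {i : ℕ}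
    (hi : i ≠ d) : Subsingleton (derivedExt R (R ⧸ maximalIdeal R) W i) :=
  (subsingleton_extMod_iff W (ResidueField R) i).1 (hW.2.1 i hi)

theorem isCanonicalModule.not_subsingleton_derivedExt (hW : isCanonicalModule R d W) :
    ¬ Subsingleton (derivedExt R (R ⧸ maximalIdeal R) W d) := fun h => by
  obtain ⟨e⟩ := hW.2.2
  have := (subsingleton_extMod_iff W (ResidueField R) d).2 h
  exact not_subsingleton (ResidueField R)
    (@Function.Injective.subsingleton _ _ _ e.symm.injective this)

variable [IsNoetherianRing R]

theorem isCanonicalModule.subsingleton_derivedExt_of_pow_smul (hW : isCanonicalModule R d W)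
    {i : ℕ} (hi : i ≠ d) {n : ℕ} (N : Type) [AddCommGroup N] [Module R N] [Module.Finite R N]
    (hN : ∀ a ∈ maximalIdeal R ^ n, ∀ x : N, a • x = 0) :
    Subsingleton (derivedExt R N W i) := by
  rw [← Module.support_eq_empty_iff (R := R), Set.eq_empty_iff_forall_notMem]
  intro q
  refine notMem_support_derivedExt_of_quotient W _ q i (fun r hr => ?_) N hN
  have hmr : r = closedPoint R := by
    refine PrimeSpectrum.ext ?_
    exact le_antisymm (le_maximalIdeal r.2.ne_top) (r.2.le_of_pow_le hr)
  subst hmr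
  have : Subsingleton (derivedExt R (R ⧸ (closedPoint R).asIdeal) W i) :=
    hW.subsingleton_derivedExt hi
  rw [Module.support_eq_empty_iff.2 this]
  exact Set.notMem_empty q

theorem isCanonicalModule.eq_zero_of_pow_smul (hd : d ≠ 0) (hW : isCanonicalModule R d W) {n : ℕ}
    {w : W} (hw : ∀ a ∈ maximalIdeal R ^ n, a • w = 0) : w = 0 := by
  have : Subsingleton (derivedExt R (R ⧸ maximalIdeal R ^ n) W 0) := by
    refine hW.subsingleton_derivedExt_of_pow_smul hd.symm (n := n) _ fun a ha x => ?_
    rw [Algebra.smul_def, Ideal.Quotient.algebraMap_eq, Ideal.Quotient.eq_zero_iff_mem.2 ha,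
      zero_mul]
  let f : (R ⧸ maximalIdeal R ^ n) →ₗ[R] W :=
    Submodule.liftQ _ (LinearMap.toSpanSingleton R W w) fun a ha => hw a ha
  have hf : ModuleCat.ofHom f = 0 :=
    Abelian.Ext.addEquiv₀.symm.injective (Subsingleton.elim _ _)
  have h1 : f (Submodule.Quotient.mk 1) = 0 :=
    congrArg (fun g => ModuleCat.Hom.hom g (Submodule.Quotient.mk 1)) hf
  exact (one_smul R w).symm.trans h1

theorem isCanonicalModule.eq_zero_of_smul_eq_zero (hd : 1 ≤ d) (hW : isCanonicalModule R d W)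
    {a : R} (ha : ∀ w : W, a • w = 0) : a = 0 := by
  have key : ∀ n : ℕ, a ∈ maximalIdeal R ^ n := by
    intro n
    by_contra han
    have hkill : ∀ b ∈ maximalIdeal R ^ n, ∀ x : R ⧸ maximalIdeal R ^ n, b • x = 0 := by
      intro b hb x
      rw [Algebra.smul_def, Ideal.Quotient.algebraMap_eq, Ideal.Quotient.eq_zero_iff_mem.2 hb,
        zero_mul]
    set f : (R ⧸ maximalIdeal R ^ n) →ₗ[R] (R ⧸ maximalIdeal R ^ n) := a • LinearMap.id with hf
    have hI : Nontrivial (LinearMap.range f) := by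
      rw [Submodule.nontrivial_iff_ne_bot, Ne, LinearMap.range_eq_bot]
      intro h0
      refine han (Ideal.Quotient.eq_zero_iff_mem.1 ?_)
      have := LinearMap.congr_fun h0 1
      simpa [hf, Algebra.smul_def] using this
    have hIkill : ∀ b ∈ maximalIdeal R ^ n, ∀ x : LinearMap.range f, b • x = 0 :=
      fun b hb x => Subtype.ext (hkill b hb x)
    -- the composite of the surjection and the injection below is multiplication by `a`
    have hsurj : Function.Surjective (extPrecomp W (LinearMap.range f).subtype d) := by
      obtain ⟨δ, hδ, -⟩ := exists_ext_connecting W (LinearMap.range f).subtype_injective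
        (LinearMap.range f).mkQ_surjective
        (LinearMap.exact_subtype_mkQ _) d
      have := hW.subsingleton_derivedExt_of_pow_smul (i := d + 1) (by lia) (n := n)
        ((R ⧸ maximalIdeal R ^ n) ⧸ LinearMap.range f) (fun b hb x => by
          obtain ⟨x, rfl⟩ := Submodule.mkQ_surjective _ x
          rw [← map_smul, hkill b hb, map_zero])
      exact fun e => hδ e (Subsingleton.elim _ _)
    have hinj : ∀ {N N' : Type} [AddCommGroup N] [Module R N] [Module.Finite R N]
        [AddCommGroup N'] [Module R N'] (g : N →ₗ[R] N') (_ : Function.Surjective g)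
        (_ : ∀ b ∈ maximalIdeal R ^ n, ∀ x : N, b • x = 0) (e : derivedExt R N' W d),
        extPrecomp W g d e = 0 → e = 0 := by
      intro N N' _ _ _ _ _ g hg hN e he
      obtain ⟨c, rfl⟩ : ∃ c, d = c + 1 := ⟨d - 1, by lia⟩
      obtain ⟨δ, -, hδ⟩ := exists_ext_connecting W (LinearMap.ker g).subtype_injective hg
        (LinearMap.exact_subtype_ker_map g) c
      have := hW.subsingleton_derivedExt_of_pow_smul (i := c) (by lia) (n := n)
        (LinearMap.ker g) (fun b hb x => Subtype.ext (hN b hb x))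
      obtain ⟨e', rfl⟩ := hδ e he
      rw [Subsingleton.elim e' 0, map_zero]
    have hzero : Subsingleton (derivedExt R (LinearMap.range f) W d) := by
      refine subsingleton_of_forall_eq 0 fun e => ?_
      obtain ⟨e, rfl⟩ := hsurj e
      refine hinj f.rangeRestrict f.surjective_rangeRestrict hkill _ ?_
      rw [← extPrecomp_comp]
      have : (LinearMap.range f).subtype ∘ₗ f.rangeRestrict = f := rfl
      rw [this, hf, extPrecomp_smul_id]
      exact ext_smul_eq_zero_of_right W ha d e
    obtain ⟨K, hK, -⟩ := (eq_top_or_exists_le_coatom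
      (⊥ : Submodule R (LinearMap.range f))).resolve_left bot_ne_top
    obtain ⟨I, hI, ⟨e⟩⟩ := isSimpleModule_iff_quot_maximal.1 (isSimpleModule_iff_isCoatom.2 hK)
    obtain rfl := eq_maximalIdeal hI
    refine hW.not_subsingleton_derivedExt (subsingleton_of_forall_eq 0 fun x => ?_)
    exact hinj (e.toLinearMap ∘ₗ K.mkQ) (e.surjective.comp K.mkQ_surjective) hIkill x
      (Subsingleton.elim _ _)
  have h := Ideal.iInf_pow_eq_bot_of_isLocalRing (maximalIdeal R) (Ideal.IsPrime.ne_top')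
  rw [← Ideal.mem_bot, ← h]
  exact (Submodule.mem_iInf _).2 key

theorem isCanonicalModule.exists_eq_colon_of_eq_colon (hd : 1 ≤ d) (hW : isCanonicalModule R d W)
    {p : Ideal R} [hp : p.IsPrime] {c : R} (hc : ∀ a, a ∈ p ↔ a * c = 0) :
    ∃ w : W, ∀ a, a ∈ p ↔ a • w = 0 := by
  have := hW.1
  obtain ⟨s, hs⟩ := Module.Finite.fg_top (R := R) (M := W)
  have hle : s.inf (fun w => LinearMap.ker (LinearMap.toSpanSingleton R W (c • w))) ≤ p := by
    intro a ha
    rw [hc]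
    refine hW.eq_zero_of_smul_eq_zero hd fun w => ?_
    have hw : w ∈ Submodule.span R (s : Set W) := hs ▸ Submodule.mem_top
    have hspan : Submodule.span R (s : Set W) ≤ LinearMap.ker (LinearMap.lsmul R W (a * c)) := by
      refine Submodule.span_le.2 fun v hv => ?_
      have := (Finset.inf_le (f := fun w => LinearMap.ker (LinearMap.toSpanSingleton R W (c • w)))
        hv) ha
      simpa [mul_smul] using this
    exact hspan hw
  obtain ⟨w, -, hw⟩ := hp.inf_le'.1 hle
  refine ⟨c • w, fun a => ⟨fun ha => ?_, fun ha => hw ha⟩⟩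
  rw [← mul_smul, (hc a).1 ha, zero_smul]

theorem isCanonicalModule.exists_height_add_le (hW : isCanonicalModule R d W)
    (hR : ringKrullDim R = d) (p : PrimeSpectrum R) :
    ∃ n : ℕ, Order.height p + n ≤ d ∧
      ∀ i, i + n ≠ d → p ∉ Module.support R (derivedExt R (R ⧸ p.1) W i) := by
  have := hW.1
  have hfin : FiniteDimensionalOrder (PrimeSpectrum R) := by
    rw [Order.finiteDimensionalOrder_iff_krullDim_ne_bot_and_top]
    change ringKrullDim R ≠ ⊥ ∧ ringKrullDim R ≠ ⊤
    rw [hR]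
    exact ⟨WithBot.coe_ne_bot, fun h => ENat.natCast_ne_top d (WithBot.coe_injective h)⟩
  have hlt : WellFoundedLT (PrimeSpectrum R) :=
    ⟨SetRel.IsWellFounded.of_finiteDimensional {(a, b) : PrimeSpectrum R × PrimeSpectrum R | a < b}⟩
  have hgt : WellFoundedGT (PrimeSpectrum R) :=
    ⟨SetRel.IsWellFounded.inv_of_finiteDimensional
      {(a, b) : PrimeSpectrum R × PrimeSpectrum R | a < b}⟩
  induction p using WellFoundedGT.induction with
  | ind p ih =>
  by_cases hmax : IsMax p
  · obtain rfl : p = closedPoint R :=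
      (hmax.eq_of_le (le_maximalIdeal p.2.ne_top : p ≤ closedPoint R))
    refine ⟨0, ?_, fun i hi => ?_⟩
    · have h := Order.height_le_krullDim (closedPoint R)
      change _ ≤ ringKrullDim R at h
      rw [hR] at h
      simpa using (by exact_mod_cast h : Order.height (closedPoint R) ≤ (d : ℕ∞))
    · have : Subsingleton (derivedExt R (R ⧸ (closedPoint R).asIdeal) W i) :=
        hW.subsingleton_derivedExt (by simpa using hi : i ≠ d)
      rw [Module.support_eq_empty_iff.2 this]
      exact Set.notMem_empty _
  · obtain ⟨q, hpq⟩ := exists_covBy_of_wellFoundedLT hmax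
    obtain ⟨n, hn, hnq⟩ := ih q hpq.lt
    refine ⟨n + 1, ?_, fun i hi => ?_⟩
    · refine le_trans ?_ hn
      have := Order.height_add_one_le hpq.lt
      calc Order.height p + ((n + 1 : ℕ) : ℕ∞) = (Order.height p + 1) + n := by
            push_cast; ring
        _ ≤ _ := by gcongr
    · exact notMem_support_derivedExt_of_covBy W hpq i (hnq (i + 1) (by lia))

theorem isCanonicalModule.notMem_support_derivedExt_one (hW : isCanonicalModule R d W)
    (hR : ringKrullDim R = d) {p : PrimeSpectrum R} {w : W} (hw : ∀ a, a ∈ p.1 ↔ a • w = 0)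
    (N : Type) [AddCommGroup N] [Module R N] [Module.Finite R N] :
    p ∉ Module.support R (derivedExt R N W 1) := by
  obtain ⟨n, hn, hp⟩ := hW.exists_height_add_le hR p
  have hnd : n = d := by
    by_contra hne
    refine hp 0 (by simpa using hne) ?_
    let f : (R ⧸ p.1) →ₗ[R] W :=
      Submodule.liftQ _ (LinearMap.toSpanSingleton R W w) fun a ha => (hw a).1 ha
    by_contra h0
    obtain ⟨s, hs, hsf⟩ := Module.notMem_support_iff'.1 h0 (Abelian.Ext.mk₀ (ModuleCat.ofHom f))
    rw [← Abelian.Ext.mk₀_smul] at hsf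
    have hsf' : s • ModuleCat.ofHom f = 0 := Abelian.Ext.addEquiv₀.symm.injective
      (hsf.trans (map_zero _).symm)
    have h1 : s • f (Submodule.Quotient.mk 1) = 0 :=
      congrArg (fun g => ModuleCat.Hom.hom g (Submodule.Quotient.mk 1)) hsf'
    have hf1 : f (Submodule.Quotient.mk 1) = w := one_smul R w
    rw [hf1] at h1
    exact hs ((hw s).2 h1)
  subst hnd
  have hmin : IsMin p := by
    rw [← Order.height_eq_zero]
    have h : Order.height p + (n : ℕ∞) ≤ 0 + n := by simpa using hn
    exact nonpos_iff_eq_zero.1 ((ENat.add_le_add_iff_right (ENat.natCast_ne_top n)).1 h)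
  refine notMem_support_derivedExt_of_quotient W ⊥ p 1 (fun r _ => ?_) N (by simp)
  by_cases hrp : r ≤ p
  · obtain rfl := hmin.eq_of_le hrp
    exact hp 1 (by lia)
  · exact notMem_support_derivedExt_quotient_of_not_le W hrp 1

theorem isCanonicalModule.exists_apply_ne_zero (hd : 1 ≤ d) (hW : isCanonicalModule R d W)
    (hR : ringKrullDim R = d) {M : Type} [AddCommGroup M] [Module R M] [Module.Finite R M]
    {p : Ideal R} (hp : p ∈ associatedPrimes R R) {y : M} (hy : ∀ a, a ∈ p ↔ a • y = 0) :
    ∃ f : M →ₗ[R] W, f y ≠ 0 := by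
  obtain ⟨hprime, c, hc⟩ := isAssociatedPrime_iff.1 hp
  obtain ⟨w, hw⟩ := hW.exists_eq_colon_of_eq_colon hd (p := p) (c := c) fun a => by
    rw [hc, Submodule.mem_colon_singleton]; simp
  let j : (R ⧸ p) →ₗ[R] M :=
    Submodule.liftQ _ (LinearMap.toSpanSingleton R M y) fun a ha => (hy a).1 ha
  let g : (R ⧸ p) →ₗ[R] W :=
    Submodule.liftQ _ (LinearMap.toSpanSingleton R W w) fun a ha => (hw a).1 ha
  have hj : Function.Injective j := by
    refine (injective_iff_map_eq_zero j).2 fun x hx => ?_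
    obtain ⟨x, rfl⟩ := Submodule.mkQ_surjective _ x
    exact (Submodule.Quotient.mk_eq_zero _).2 ((hy x).2 hx)
  obtain ⟨δ, hδ, -⟩ := exists_ext_connecting W hj (LinearMap.range j).mkQ_surjective
    (LinearMap.exact_map_mkQ_range j) 0
  obtain ⟨s, hs, hsg⟩ := Module.notMem_support_iff'.1
    (hW.notMem_support_derivedExt_one hR (p := ⟨p, hprime⟩) hw (M ⧸ LinearMap.range j))
    (δ (Abelian.Ext.mk₀ (ModuleCat.ofHom g)))
  rw [← map_smul] at hsg
  obtain ⟨e, he⟩ := hδ _ hsg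
  obtain ⟨f, rfl⟩ := Abelian.Ext.addEquiv₀.symm.surjective e
  have hfg : ModuleCat.ofHom j ≫ f = s • ModuleCat.ofHom g := by
    apply Abelian.Ext.addEquiv₀.symm.injective
    simpa [extPrecomp, Abelian.Ext.precompOfLinear, Abelian.Ext.mk₀_smul] using he
  refine ⟨f.hom, fun hfy => hs ((hw s).2 ?_)⟩
  have h1 : f.hom (j (Submodule.Quotient.mk 1)) = s • g (Submodule.Quotient.mk 1) :=
    congrArg (fun g => ModuleCat.Hom.hom g (Submodule.Quotient.mk 1)) hfg
  have hj1 : j (Submodule.Quotient.mk 1) = y := one_smul R y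
  have hg1 : g (Submodule.Quotient.mk 1) = w := one_smul R w
  rw [hj1, hg1, hfy] at h1
  exact h1.symm

end CanonicalModule

theorem mem_mTorsion_of_associatedPrimes_subset {R : Type} [CommRing R] [IsNoetherianRing R]
    [IsLocalRing R] {M : Type} [AddCommGroup M] [Module R M] [Module.Finite R M]
    {K : Submodule R M} (hK : associatedPrimes R K ⊆ {maximalIdeal R}) : K ≤ mTorsion R M := by
  have hrad : maximalIdeal R ≤ (Module.annihilator R K).radical := by
    rw [← Ideal.sInf_minimalPrimes]
    refine le_sInf fun q hq => ?_
    rw [hK (Module.associatedPrimes.minimalPrimes_annihilator_subset_associatedPrimes R K hq)]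
  obtain ⟨n, hn⟩ := Ideal.exists_pow_le_of_le_radical_of_fg hrad (IsNoetherian.noetherian _)
  refine le_trans (fun x hx => ?_) (le_iSup _ n)
  rw [Submodule.mem_torsionBySet_iff]
  rintro ⟨a, ha⟩
  exact congrArg Subtype.val (Module.mem_annihilator.1 (hn ha) ⟨x, hx⟩)

/-- Over a Cohen-Macaulay Noetherian local ring of dimension `d ≥ 1` with
canonical module `ω`, if `Ass M ⊆ Ass R ∪ {𝔪}` and `M` satisfies `(S₂)` on the punctured
spectrum, then the kernel of the evaluation map `φ : M → Hom(Hom(M,ω),ω)` is the `𝔪`-torsion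
submodule `Γ_𝔪(M)`. -/
theorem statement8 (R : Type) [CommRing R] [IsNoetherianRing R] [IsLocalRing R]
    (d : ℕ) (hd : 1 ≤ d) (hR : isCMLocalRing R d)
    (ω : Type) [AddCommGroup ω] [Module R ω] (hω : isCanonicalModule R d ω)
    (M : Type) [AddCommGroup M] [Module R M] [Module.Finite R M]
    (hAss : associatedPrimes R M ⊆ associatedPrimes R R ∪ {maximalIdeal R})
    (hS2 : serreS2Punctured R M) :
    LinearMap.ker (evMap R M ω) = mTorsion R M := by
  refine le_antisymm (mem_mTorsion_of_associatedPrimes_subset fun p hp => ?_) ?_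
  · refine (hAss (associatedPrimes.subset_of_injective
      (LinearMap.ker (evMap R M ω)).subtype_injective hp)).resolve_left fun hpR => ?_
    obtain ⟨-, ⟨y, hyK⟩, hy⟩ := isAssociatedPrime_iff.1 hp
    obtain ⟨f, hf⟩ := hω.exists_apply_ne_zero hd hR.1 hpR (y := y) fun a => by
      rw [hy, Submodule.mem_colon_singleton, Submodule.mem_bot, ← Subtype.coe_inj]
      rfl
    exact hf (LinearMap.congr_fun (LinearMap.mem_ker.1 hyK) f)
  · refine iSup_le fun n x hx => LinearMap.mem_ker.2 (LinearMap.ext fun f => ?_)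
    refine hω.eq_zero_of_pow_smul (by lia) (n := n) fun a ha => ?_
    have hax : a • x = 0 := (Submodule.mem_torsionBySet_iff _ _).1 hx ⟨a, ha⟩
    rw [← LinearMap.smul_apply, ← map_smul, hax]
    simp
end
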